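/- For the infinite strip (I = ℝ): for every integer j ≥ 1, the Courant–Fischer min–max values λ_j(ε) of the Dirichlet Laplacian on Ω_ε satisfy lim_{ε→0⁺} ε^{2α} ( λ_j(ε) − π²/(M² ε²) ) = μ_j. -/

import Mathlib

open MeasureTheory Real Filter Set

/-- `|∇ψ|² = (∂ₓψ)² + (∂_yψ)²` for a function `ψ : ℝ² → ℝ`. -/
noncomputable def gradSq (ψ : ℝ × ℝ → ℝ) (p : ℝ × ℝ) : ℝ :=
  (deriv (fun s => ψ (s, p.2)) p.1) ^ 2 + (deriv (fun t => ψ (p.1, t)) p.2) ^ 2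

/-- The `j`-th Courant–Fischer min–max value of the Dirichlet Laplacian on an open
set `Ω ⊆ ℝ²`: the infimum over `j`-dimensional subspaces `F` of `C_c^∞(Ω)` of the
supremum of the Rayleigh quotient over nonzero `ψ ∈ F`. -/
noncomputable def dirichletMinMax (Ω : Set (ℝ × ℝ)) (j : ℕ) : ℝ :=
  sInf { r : ℝ | ∃ F : Submodule ℝ ((ℝ × ℝ) → ℝ),
    Module.finrank ℝ F = j ∧
    (∀ ψ ∈ F, ContDiff ℝ (⊤ : ℕ∞) ψ ∧ HasCompactSupport ψ ∧ tsupport ψ ⊆ Ω) ∧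
    r = sSup { s : ℝ | ∃ ψ ∈ F, ψ ≠ (0 : (ℝ × ℝ) → ℝ) ∧
      s = (∫ p in Ω, gradSq ψ p) / (∫ p in Ω, (ψ p) ^ 2) } }

/-- The `j`-th min–max value of the Schrödinger operator `−d²/dx² + q` on `L²(ℝ)`. -/
noncomputable def schroedingerMinMax (q : ℝ → ℝ) (j : ℕ) : ℝ :=
  sInf { r : ℝ | ∃ F : Submodule ℝ (ℝ → ℝ),
    Module.finrank ℝ F = j ∧
    (∀ χ ∈ F, ContDiff ℝ (⊤ : ℕ∞) χ ∧ HasCompactSupport χ) ∧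
    r = sSup { s : ℝ | ∃ χ ∈ F, χ ≠ (0 : ℝ → ℝ) ∧
      s = (∫ x : ℝ, (deriv χ x ^ 2 + q x * χ x ^ 2)) / (∫ x : ℝ, χ x ^ 2) } }

lemma aux_tendsto_sq_div {g s : ℝ → ℝ} {a g' s' : ℝ} (hg : HasDerivAt g g' a)
    (hs : HasDerivAt s s' a) (ga : g a = 0) (sa : s a = 0) (hs' : s' ≠ 0) :
    ContinuousAt (fun y => g y ^ 2 / s y) a := by
  have h1 := hg.tendsto_slope
  have h2 := hs.tendsto_slope
  have h3 : Tendsto (fun y => g y * (slope g a y / slope s a y)) (nhdsWithin a {a}ᶜ)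
      (nhds (0 * (g' / s'))) := by
    refine Tendsto.mul ?_ (h1.div h2 hs')
    have := hg.continuousAt.tendsto
    rw [ga] at this
    exact this.mono_left nhdsWithin_le_nhds
  rw [zero_mul] at h3
  rw [continuousAt_iff_punctured_nhds]
  simp only [ga, sa]
  have h4 : (0:ℝ)^2/0 = 0 := by simp
  rw [h4]
  refine h3.congr' ?_
  filter_upwards [self_mem_nhdsWithin] with y hy
  have hya : y - a ≠ 0 := sub_ne_zero.mpr hy
  rw [slope_def_field, slope_def_field, ga, sa, sub_zero, sub_zero, div_div_div_cancel_right₀ hya]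
  ring

lemma poincare (g g' : ℝ → ℝ) (hg : ∀ x, HasDerivAt g (g' x) x) (hc : Continuous g')
    (a b : ℝ) (hab : a < b) (ga : g a = 0) (gb : g b = 0) :
    (π / (b - a)) ^ 2 * ∫ x in a..b, g x ^ 2 ≤ ∫ x in a..b, g' x ^ 2 := by
  set c := π / (b - a) with hcdef
  have hba : 0 < b - a := sub_pos.mpr hab
  have hcpos : 0 < c := div_pos pi_pos hba
  have hgc : Continuous g := continuous_iff_continuousAt.mpr fun x => (hg x).continuousAt
  have hcb : c * (b - a) = π := by rw [hcdef]; field_simp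
  have hsin : ∀ y, HasDerivAt (fun y => Real.sin (c * (y - a))) (c * Real.cos (c * (y - a))) y := by
    intro y
    have h1 : HasDerivAt (fun y => c * (y - a)) c y := by
      simpa using ((hasDerivAt_id y).sub_const a).const_mul c
    have := (Real.hasDerivAt_sin (c * (y - a))).comp y h1
    simpa [mul_comm, Function.comp_def] using this
  have hcos : ∀ y, HasDerivAt (fun y => Real.cos (c * (y - a))) (-(c * Real.sin (c * (y - a)))) y := by
    intro y
    have h1 : HasDerivAt (fun y => c * (y - a)) c y := by
      simpa using ((hasDerivAt_id y).sub_const a).const_mul c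
    have := (Real.hasDerivAt_cos (c * (y - a))).comp y h1
    simpa [mul_comm, Function.comp_def] using this
  have hpos : ∀ y ∈ Ioo a b, 0 < Real.sin (c * (y - a)) := by
    intro y hy
    apply Real.sin_pos_of_pos_of_lt_pi
    · exact mul_pos hcpos (by linarith [hy.1])
    · rw [← hcb]; exact mul_lt_mul_of_pos_left (by linarith [hy.2]) hcpos
  set G : ℝ → ℝ := fun y => c * Real.cos (c * (y - a)) * (g y ^ 2 / Real.sin (c * (y - a))) with hG
  have hGd : ∀ y ∈ Ioo a b, HasDerivAt G
      (c * -(c * Real.sin (c * (y - a))) * (g y ^ 2 / Real.sin (c * (y - a))) +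
        c * Real.cos (c * (y - a)) * ((2 * g y * g' y * Real.sin (c * (y - a)) - g y ^ 2 * (c * Real.cos (c * (y - a)))) / Real.sin (c * (y - a)) ^ 2)) y := by
    intro y hy
    have h1 := ((hcos y).const_mul c).mul ((((hg y).pow 2)).div (hsin y) (hpos y hy).ne')
    refine HasDerivAt.congr_deriv (f := G) h1 ?_
    simp
  have hcont : ContinuousOn G (Icc a b) := by
    intro y hy
    apply ContinuousAt.continuousWithinAt
    have hcc : ContinuousAt (fun y => c * Real.cos (c * (y - a))) y := by fun_prop
    refine hcc.mul ?_
    rcases eq_or_lt_of_le hy.1 with rfl | h1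
    · exact aux_tendsto_sq_div (hg a) (hsin a) ga (by simp) (by simp [hcpos.ne'])
    · rcases eq_or_lt_of_le hy.2 with rfl | h2
      · exact aux_tendsto_sq_div (hg y) (hsin y) gb (by rw [hcb]; simp) (by rw [hcb]; simp [hcpos.ne'])
      · exact ContinuousAt.div (by fun_prop) (by fun_prop) (hpos y ⟨h1, h2⟩).ne'
  have key := intervalIntegral.sub_le_integral_of_hasDeriv_right_of_le (g := G)
    (φ := fun y => g' y ^ 2 - c ^ 2 * g y ^ 2) hab.le hcont
    (fun y hy => (hGd y hy).hasDerivWithinAt)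
    ((by fun_prop : Continuous (fun y => g' y ^ 2 - c ^ 2 * g y ^ 2)).integrableOn_Icc) ?_
  · have e1 : G b - G a = 0 := by simp [hG, ga, gb]
    rw [e1, intervalIntegral.integral_sub, intervalIntegral.integral_const_mul] at key
    · linarith
    · exact (by fun_prop : Continuous (fun y => g' y ^ 2)).intervalIntegrable _ _
    · exact (by fun_prop : Continuous (fun y => c ^ 2 * g y ^ 2)).intervalIntegrable _ _
  · intro y hy
    have hs := hpos y hy
    have h1 := Real.sin_sq_add_cos_sq (c * (y - a))
    set S := Real.sin (c * (y - a))
    set C := Real.cos (c * (y - a))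
    have : g' y ^ 2 - c ^ 2 * g y ^ 2 - (c * -(c * S) * (g y ^ 2 / S) + c * C * ((2 * g y * g' y * S - g y ^ 2 * (c * C)) / S ^ 2)) = (g' y - c * C / S * g y) ^ 2 := by
      field_simp
      ring
    nlinarith [sq_nonneg (g' y - c * C / S * g y)]

/-- gap inequality -/
lemma gap (f f' : ℝ → ℝ) (hf : ∀ x, HasDerivAt f (f' x) x) (hc : Continuous f')
    (l : ℝ) (hl : 0 < l) (f0 : f 0 = 0) (fl : f l = 0) :
    (π / l) ^ 2 * (4 * (∫ x in (0:ℝ)..l, f x ^ 2) - 3 * ((2 / l) * (∫ x in (0:ℝ)..l, f x * Real.sin (π / l * x)) ^ 2))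
      ≤ ∫ x in (0:ℝ)..l, f' x ^ 2 := by
  set c := π / l with hcdef
  have hcl : c * l = π := by rw [hcdef]; field_simp
  have hfc : Continuous f := continuous_iff_continuousAt.mpr fun x => (hf x).continuousAt
  set b := f (l / 2) with hb
  have hsin : ∀ y, HasDerivAt (fun y => Real.sin (c * y)) (c * Real.cos (c * y)) y := by
    intro y
    have h1 : HasDerivAt (fun y => c * y) c y := by
      simpa using (hasDerivAt_id y).const_mul c
    have := (Real.hasDerivAt_sin (c * y)).comp y h1
    simpa [mul_comm, Function.comp_def] using this
  have hcos : ∀ y, HasDerivAt (fun y => Real.cos (c * y)) (-(c * Real.sin (c * y))) y := by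
    intro y
    have h1 : HasDerivAt (fun y => c * y) c y := by
      simpa using (hasDerivAt_id y).const_mul c
    have := (Real.hasDerivAt_cos (c * y)).comp y h1
    simpa [mul_comm, Function.comp_def] using this
  set g : ℝ → ℝ := fun y => f y - b * Real.sin (c * y) with hg
  set g' : ℝ → ℝ := fun y => f' y - b * (c * Real.cos (c * y)) with hg'
  have hgd : ∀ y, HasDerivAt g (g' y) y := fun y => (hf y).sub ((hsin y).const_mul b)
  have hg'c : Continuous g' := by fun_prop
  have hgc : Continuous g := by fun_prop
  have g0 : g 0 = 0 := by simp [hg, f0]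
  have gl : g l = 0 := by simp [hg, fl, hcl]
  have gm : g (l / 2) = 0 := by
    have : c * (l / 2) = π / 2 := by rw [← hcl]; ring
    simp [hg, this, hb]
  have p1 := poincare g g' hgd hg'c 0 (l / 2) (by linarith) g0 gm
  have p2 := poincare g g' hgd hg'c (l / 2) l (by linarith) gm gl
  have e1 : π / (l / 2 - 0) = 2 * c := by rw [hcdef, sub_zero]; field_simp
  have e2 : π / (l - l / 2) = 2 * c := by rw [hcdef, show l - l / 2 = l / 2 by ring]; field_simp
  rw [e1] at p1
  rw [e2] at p2
  have ii : ∀ F : ℝ → ℝ, Continuous F → ∀ a b, IntervalIntegrable F volume a b :=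
    fun F hF a b => hF.intervalIntegrable a b
  have s1 := intervalIntegral.integral_add_adjacent_intervals (ii (fun y => g y ^ 2) (by fun_prop) 0 (l/2)) (ii _ (by fun_prop) (l/2) l)
  have s2 := intervalIntegral.integral_add_adjacent_intervals (ii (fun y => g' y ^ 2) (by fun_prop) 0 (l/2)) (ii _ (by fun_prop) (l/2) l)
  have p3 : (2 * c) ^ 2 * ∫ y in (0:ℝ)..l, g y ^ 2 ≤ ∫ y in (0:ℝ)..l, g' y ^ 2 := by
    rw [← s1, ← s2]; linarith
  -- expand
  have hss : ∫ y in (0:ℝ)..l, Real.sin (c * y) ^ 2 = l / 2 := by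
    have h1 : ∀ y ∈ uIcc 0 l, HasDerivAt (fun y => y / 2 - Real.sin (c * y) * Real.cos (c * y) / (2 * c)) (Real.sin (c * y) ^ 2) y := by
      intro y _
      have hc0 : c ≠ 0 := (div_pos pi_pos hl).ne'
      have := ((hasDerivAt_id y).div_const 2).sub (((hsin y).mul (hcos y)).div_const (2 * c))
      refine this.congr_deriv ?_
      have h2 := Real.cos_sq' (c * y)
      field_simp
      rw [h2]
      ring
    rw [intervalIntegral.integral_eq_sub_of_hasDerivAt h1 (ii _ (by fun_prop) _ _)]
    simp [hcl]
  have hcc : ∫ y in (0:ℝ)..l, Real.cos (c * y) ^ 2 = l / 2 := by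
    have : ∫ y in (0:ℝ)..l, Real.cos (c * y) ^ 2 = ∫ y in (0:ℝ)..l, (1 - Real.sin (c * y) ^ 2) := by
      congr 1; ext y; have := Real.sin_sq_add_cos_sq (c * y); linarith
    rw [this, intervalIntegral.integral_sub (ii _ (by fun_prop) _ _) (ii _ (by fun_prop) _ _), hss]
    simp; ring
  have hparts : ∫ y in (0:ℝ)..l, f' y * Real.cos (c * y) = c * ∫ y in (0:ℝ)..l, f y * Real.sin (c * y) := by
    have h1 : ∀ y ∈ uIcc 0 l, HasDerivAt (fun y => f y * Real.cos (c * y)) (f' y * Real.cos (c * y) - c * (f y * Real.sin (c * y))) y := by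
      intro y _
      refine ((hf y).mul (hcos y)).congr_deriv ?_
      ring
    have h2 := intervalIntegral.integral_eq_sub_of_hasDerivAt h1 (ii _ (by fun_prop) _ _)
    rw [intervalIntegral.integral_sub (ii _ (by fun_prop) _ _) (ii _ (by fun_prop) _ _), intervalIntegral.integral_const_mul] at h2
    simp only [f0, fl] at h2
    linarith
  have x1 : ∫ y in (0:ℝ)..l, g y ^ 2 = (∫ y in (0:ℝ)..l, f y ^ 2) - 2 * b * (∫ y in (0:ℝ)..l, f y * Real.sin (c * y)) + b ^ 2 * (l / 2) := by
    have : ∀ y, g y ^ 2 = f y ^ 2 - 2 * b * (f y * Real.sin (c * y)) + b ^ 2 * Real.sin (c * y) ^ 2 := by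
      intro y; simp only [hg]; ring
    simp_rw [this]
    rw [intervalIntegral.integral_add (ii _ (by fun_prop) _ _) (ii _ (by fun_prop) _ _), intervalIntegral.integral_sub (ii _ (by fun_prop) _ _) (ii _ (by fun_prop) _ _), intervalIntegral.integral_const_mul, intervalIntegral.integral_const_mul, hss]
  have x2 : ∫ y in (0:ℝ)..l, g' y ^ 2 = (∫ y in (0:ℝ)..l, f' y ^ 2) - 2 * b * c * (c * ∫ y in (0:ℝ)..l, f y * Real.sin (c * y)) + b ^ 2 * c ^ 2 * (l / 2) := by
    have : ∀ y, g' y ^ 2 = f' y ^ 2 - 2 * b * c * (f' y * Real.cos (c * y)) + b ^ 2 * c ^ 2 * Real.cos (c * y) ^ 2 := by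
      intro y; simp only [hg']; ring
    simp_rw [this]
    rw [intervalIntegral.integral_add (ii _ (by fun_prop) _ _) (ii _ (by fun_prop) _ _), intervalIntegral.integral_sub (ii _ (by fun_prop) _ _) (ii _ (by fun_prop) _ _), intervalIntegral.integral_const_mul, intervalIntegral.integral_const_mul, hcc, hparts]
  rw [x1, x2] at p3
  set s := ∫ y in (0:ℝ)..l, f y * Real.sin (c * y)
  have hs : 2 / l * s ^ 2 - (2 * b * s - b ^ 2 * (l / 2)) = (l / 2) * (b - 2 / l * s) ^ 2 := by
    field_simp; ring
  have hs2 : 0 ≤ c ^ 2 * ((l / 2) * (b - 2 / l * s) ^ 2) := by positivity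
  rw [← hs] at hs2
  nlinarith

/-- Bessel -/
lemma bessel (f : ℝ → ℝ) (hfc : Continuous f) (l : ℝ) (hl : 0 < l) :
    (2 / l) * (∫ x in (0:ℝ)..l, f x * Real.sin (π / l * x)) ^ 2 ≤ ∫ x in (0:ℝ)..l, f x ^ 2 := by
  set c := π / l with hcdef
  have hcl : c * l = π := by rw [hcdef]; field_simp
  have hsin : ∀ y, HasDerivAt (fun y => Real.sin (c * y)) (c * Real.cos (c * y)) y := by
    intro y
    have h1 : HasDerivAt (fun y => c * y) c y := by
      simpa using (hasDerivAt_id y).const_mul c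
    have := (Real.hasDerivAt_sin (c * y)).comp y h1
    simpa [mul_comm, Function.comp_def] using this
  have hcos : ∀ y, HasDerivAt (fun y => Real.cos (c * y)) (-(c * Real.sin (c * y))) y := by
    intro y
    have h1 : HasDerivAt (fun y => c * y) c y := by
      simpa using (hasDerivAt_id y).const_mul c
    have := (Real.hasDerivAt_cos (c * y)).comp y h1
    simpa [mul_comm, Function.comp_def] using this
  have ii : ∀ F : ℝ → ℝ, Continuous F → ∀ a b, IntervalIntegrable F volume a b :=
    fun F hF a b => hF.intervalIntegrable a b
  have hss : ∫ y in (0:ℝ)..l, Real.sin (c * y) ^ 2 = l / 2 := by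
    have h1 : ∀ y ∈ uIcc 0 l, HasDerivAt (fun y => y / 2 - Real.sin (c * y) * Real.cos (c * y) / (2 * c)) (Real.sin (c * y) ^ 2) y := by
      intro y _
      have hc0 : c ≠ 0 := (div_pos pi_pos hl).ne'
      have := ((hasDerivAt_id y).div_const 2).sub (((hsin y).mul (hcos y)).div_const (2 * c))
      refine this.congr_deriv ?_
      have h2 := Real.cos_sq' (c * y)
      field_simp
      rw [h2]
      ring
    rw [intervalIntegral.integral_eq_sub_of_hasDerivAt h1 (ii _ (by fun_prop) _ _)]
    simp [hcl]
  set s := ∫ y in (0:ℝ)..l, f y * Real.sin (c * y) with hs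
  set b := 2 / l * s with hb
  have h0 : 0 ≤ ∫ y in (0:ℝ)..l, (f y - b * Real.sin (c * y)) ^ 2 :=
    intervalIntegral.integral_nonneg hl.le fun y _ => sq_nonneg _
  have : ∀ y, (f y - b * Real.sin (c * y)) ^ 2 = f y ^ 2 - 2 * b * (f y * Real.sin (c * y)) + b ^ 2 * Real.sin (c * y) ^ 2 := by
    intro y; ring
  simp_rw [this] at h0
  rw [intervalIntegral.integral_add (ii _ (by fun_prop) _ _) (ii _ (by fun_prop) _ _), intervalIntegral.integral_sub (ii _ (by fun_prop) _ _) (ii _ (by fun_prop) _ _), intervalIntegral.integral_const_mul, intervalIntegral.integral_const_mul, hss, ← hs] at h0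
  have : - 2 * b * s + b ^ 2 * (l / 2) = - (2 / l * s ^ 2) := by
    rw [hb]; field_simp; ring
  linarith

noncomputable def dX (ψ : ℝ × ℝ → ℝ) (p : ℝ × ℝ) : ℝ := fderiv ℝ ψ p (1, 0)
noncomputable def dY (ψ : ℝ × ℝ → ℝ) (p : ℝ × ℝ) : ℝ := fderiv ℝ ψ p (0, 1)
noncomputable def PI (ψ : ℝ × ℝ → ℝ) (w : ℝ → ℝ) (x : ℝ) : ℝ := ∫ y, ψ (x, y) * w y

section slices
variable {ψ : ℝ × ℝ → ℝ}

lemma dX_smooth (h : ContDiff ℝ (⊤ : ℕ∞) ψ) : ContDiff ℝ (⊤ : ℕ∞) (dX ψ) :=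
  (h.fderiv_right (m := (⊤ : ℕ∞)) (by simp)).clm_apply contDiff_const
lemma dY_smooth (h : ContDiff ℝ (⊤ : ℕ∞) ψ) : ContDiff ℝ (⊤ : ℕ∞) (dY ψ) :=
  (h.fderiv_right (m := (⊤ : ℕ∞)) (by simp)).clm_apply contDiff_const
lemma dX_cs (h : HasCompactSupport ψ) : HasCompactSupport (dX ψ) := h.fderiv_apply ℝ (1, 0)
lemma dY_cs (h : HasCompactSupport ψ) : HasCompactSupport (dY ψ) := h.fderiv_apply ℝ (0, 1)

lemma hasDerivAt_sliceX (h : ContDiff ℝ (⊤ : ℕ∞) ψ) (x y : ℝ) :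
    HasDerivAt (fun s => ψ (s, y)) (dX ψ (x, y)) x := by
  have h1 := (h.differentiable (by simp) (x, y)).hasFDerivAt
  have h2 : HasDerivAt (fun s : ℝ => (s, y)) ((1 : ℝ), (0 : ℝ)) x :=
    (hasDerivAt_id x).prodMk (hasDerivAt_const x y)
  exact h1.comp_hasDerivAt x h2
lemma hasDerivAt_sliceY (h : ContDiff ℝ (⊤ : ℕ∞) ψ) (x y : ℝ) :
    HasDerivAt (fun s => ψ (x, s)) (dY ψ (x, y)) y := by
  have h1 := (h.differentiable (by simp) (x, y)).hasFDerivAt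
  have h2 : HasDerivAt (fun s : ℝ => (x, s)) ((0 : ℝ), (1 : ℝ)) y :=
    (hasDerivAt_const y x).prodMk (hasDerivAt_id y)
  exact h1.comp_hasDerivAt y h2

lemma gradSq_eq (h : ContDiff ℝ (⊤ : ℕ∞) ψ) (p : ℝ × ℝ) :
    gradSq ψ p = dX ψ p ^ 2 + dY ψ p ^ 2 := by
  unfold gradSq
  rw [(hasDerivAt_sliceX h p.1 p.2).deriv, (hasDerivAt_sliceY h p.1 p.2).deriv]

lemma tsupport_dX_sub (ψ : ℝ × ℝ → ℝ) : tsupport (dX ψ) ⊆ tsupport ψ := by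
  exact tsupport_fderiv_apply_subset ℝ (1, 0)
lemma tsupport_dY_sub (ψ : ℝ × ℝ → ℝ) : tsupport (dY ψ) ⊆ tsupport ψ := by
  exact tsupport_fderiv_apply_subset ℝ (0, 1)

lemma PI_hasDeriv (h : ContDiff ℝ (⊤ : ℕ∞) ψ) (hs : HasCompactSupport ψ) {w : ℝ → ℝ}
    (hw : Continuous w) (x : ℝ) : HasDerivAt (PI ψ w) (PI (dX ψ) w x) x := by
  have hdc : Continuous (dX ψ) := (dX_smooth h).continuous
  have hψc : Continuous ψ := h.continuous
  obtain ⟨C, hC⟩ := hdc.bounded_above_of_compact_support (dX_cs hs)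
  have hK : IsCompact (Prod.snd '' tsupport ψ) := hs.isCompact.image continuous_snd
  refine (hasDerivAt_integral_of_dominated_loc_of_deriv_le (F := fun s y => ψ (s, y) * w y)
    (F' := fun s y => dX ψ (s, y) * w y) (s := univ)
    (bound := (Prod.snd '' tsupport ψ).indicator fun y => C * |w y|) univ_mem ?_ ?_ ?_ ?_ ?_ ?_).2
  · exact Eventually.of_forall fun s => (by fun_prop : Continuous fun y => ψ (s, y) * w y).aestronglyMeasurable
  · refine (by fun_prop : Continuous fun y => ψ (x, y) * w y).integrable_of_hasCompactSupport ?_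
    refine HasCompactSupport.intro hK fun y hy => ?_
    rw [image_eq_zero_of_notMem_tsupport (f := ψ), zero_mul]
    exact fun hh => hy ⟨_, hh, rfl⟩
  · exact (by fun_prop : Continuous fun y => dX ψ (x, y) * w y).aestronglyMeasurable
  · refine Eventually.of_forall fun y s _ => ?_
    by_cases hy : y ∈ Prod.snd '' tsupport ψ
    · rw [indicator_of_mem hy, norm_mul, Real.norm_eq_abs (w y)]
      exact mul_le_mul_of_nonneg_right (hC _) (abs_nonneg _)
    · rw [indicator_of_notMem hy, image_eq_zero_of_notMem_tsupport (f := dX ψ), zero_mul, norm_zero]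
      exact fun hh => hy ⟨_, tsupport_dX_sub ψ hh, rfl⟩
  · rw [integrable_indicator_iff hK.measurableSet]
    exact (by fun_prop : Continuous fun y => C * |w y|).continuousOn.integrableOn_compact hK
  · exact Eventually.of_forall fun y s _ => (hasDerivAt_sliceX h s y).mul_const _

lemma PI_deriv (h : ContDiff ℝ (⊤ : ℕ∞) ψ) (hs : HasCompactSupport ψ) {w : ℝ → ℝ}
    (hw : Continuous w) : deriv (PI ψ w) = PI (dX ψ) w :=
  funext fun x => (PI_hasDeriv h hs hw x).deriv

lemma PI_smooth_nat {w : ℝ → ℝ} (hw : Continuous w) (n : ℕ) : ∀ ψ : ℝ × ℝ → ℝ,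
    ContDiff ℝ (⊤ : ℕ∞) ψ → HasCompactSupport ψ → ContDiff ℝ n (PI ψ w) := by
  induction n with
  | zero =>
    intro ψ h hs
    exact contDiff_zero.mpr (continuous_iff_continuousAt.mpr fun x => (PI_hasDeriv h hs hw x).continuousAt)
  | succ n ih =>
    intro ψ h hs
    have := (contDiff_succ_iff_deriv (𝕜 := ℝ) (n := (n : WithTop ℕ∞)) (f := PI ψ w)).mpr
      ⟨fun x => (PI_hasDeriv h hs hw x).differentiableAt, by simp, by
        rw [PI_deriv h hs hw]; exact ih _ (dX_smooth h) (dX_cs hs)⟩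
    exact_mod_cast this

lemma PI_smooth (h : ContDiff ℝ (⊤ : ℕ∞) ψ) (hs : HasCompactSupport ψ) {w : ℝ → ℝ}
    (hw : Continuous w) : ContDiff ℝ (⊤ : ℕ∞) (PI ψ w) :=
  contDiff_infty.mpr fun n => PI_smooth_nat hw n ψ h hs

lemma PI_cs (hs : HasCompactSupport ψ) (w : ℝ → ℝ) : HasCompactSupport (PI ψ w) := by
  refine HasCompactSupport.intro (hs.isCompact.image continuous_fst) fun x hx => ?_
  unfold PI
  have : ∀ y, ψ (x, y) * w y = 0 := fun y => by
    rw [image_eq_zero_of_notMem_tsupport (f := ψ), zero_mul]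
    exact fun hh => hx ⟨_, hh, rfl⟩
  simp [this]

lemma integral_eq_PI (h : Continuous ψ) (hs : HasCompactSupport ψ) :
    ∫ p, ψ p = ∫ x, PI ψ (fun _ => 1) x := by
  have hi : Integrable ψ (volume.prod volume) := by
    rw [← Measure.volume_eq_prod]; exact h.integrable_of_hasCompactSupport hs
  rw [Measure.volume_eq_prod, integral_prod _ hi]
  simp [PI]

lemma setInt_sq {Ω : Set (ℝ × ℝ)} (hΩ : tsupport ψ ⊆ Ω) :
    ∫ p in Ω, ψ p ^ 2 = ∫ p, ψ p ^ 2 := by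
  refine setIntegral_eq_integral_of_forall_compl_eq_zero fun p hp => ?_
  rw [image_eq_zero_of_notMem_tsupport fun hh => hp (hΩ hh)]; simp

lemma setInt_grad {Ω : Set (ℝ × ℝ)} (h : ContDiff ℝ (⊤ : ℕ∞) ψ) (hΩ : tsupport ψ ⊆ Ω) :
    ∫ p in Ω, gradSq ψ p = ∫ p, (dX ψ p ^ 2 + dY ψ p ^ 2) := by
  simp_rw [gradSq_eq h]
  refine setIntegral_eq_integral_of_forall_compl_eq_zero fun p hp => ?_
  rw [image_eq_zero_of_notMem_tsupport fun hh => hp (hΩ (tsupport_dX_sub ψ hh)),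
    image_eq_zero_of_notMem_tsupport fun hh => hp (hΩ (tsupport_dY_sub ψ hh))]; simp

lemma sq_smooth (h : ContDiff ℝ (⊤ : ℕ∞) ψ) : ContDiff ℝ (⊤ : ℕ∞) (fun p => ψ p ^ 2) := h.pow 2
lemma sq_cs {X : Type*} [TopologicalSpace X] {f : X → ℝ} (hs : HasCompactSupport f) :
    HasCompactSupport (fun p => f p ^ 2) :=
  hs.comp_left (g := fun x : ℝ => x ^ 2) (by simp)

end slices

lemma ratio_bdd {V : Type*} [AddCommGroup V] [Module ℝ V] [FiniteDimensional ℝ V]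
    (N D : LinearMap.BilinForm ℝ V) (hD : ∀ v, v ≠ 0 → 0 < D v v) :
    ∃ C, ∀ v, v ≠ 0 → N v v / D v v ≤ C := by
  let b := Module.finBasis ℝ V
  let e := b.equivFun.symm
  have hcont : ∀ B : LinearMap.BilinForm ℝ V, Continuous fun c : Fin (Module.finrank ℝ V) → ℝ => B (e c) (e c) := by
    intro B
    have : ∀ c, B (e c) (e c) = ∑ i, ∑ k, c i * (c k * B (b k) (b i)) := by
      intro c
      simp only [e, Module.Basis.equivFun_symm_apply, map_sum, LinearMap.sum_apply, map_smul, LinearMap.smul_apply, smul_eq_mul, Finset.mul_sum]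
    simp_rw [this]
    fun_prop
  have hne : ∀ c ∈ Metric.sphere (0 : Fin (Module.finrank ℝ V) → ℝ) 1, e c ≠ 0 := by
    intro c hc h0
    have : c = 0 := by simpa using h0
    simp [this] at hc
  have hb : BddAbove ((fun c => N (e c) (e c) / D (e c) (e c)) '' Metric.sphere (0 : Fin (Module.finrank ℝ V) → ℝ) 1) := by
    refine (isCompact_sphere _ _).bddAbove_image ?_
    exact (hcont N).continuousOn.div (hcont D).continuousOn fun c hc => (hD _ (hne c hc)).ne'
  obtain ⟨C, hC⟩ := hb
  refine ⟨C, fun v hv => ?_⟩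
  set c := e.symm v with hc
  have hc0 : c ≠ 0 := by simpa [hc] using hv
  have hn : ‖c‖ ≠ 0 := norm_ne_zero_iff.mpr hc0
  have hmem : ‖c‖⁻¹ • c ∈ Metric.sphere (0 : Fin (Module.finrank ℝ V) → ℝ) 1 := by
    simp [norm_smul, hn]
  have h1 := hC ⟨_, hmem, rfl⟩
  have h2 : e (‖c‖⁻¹ • c) = ‖c‖⁻¹ • v := by rw [map_smul, hc, LinearEquiv.apply_symm_apply]
  simp only [h2, map_smul, LinearMap.smul_apply, smul_eq_mul] at h1
  convert h1 using 1
  rw [mul_div_mul_left _ _ (inv_ne_zero hn), mul_div_mul_left _ _ (inv_ne_zero hn)]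

lemma quad_bilin {V X : Type*} [AddCommGroup V] [Module ℝ V] [MeasurableSpace X] (μ : Measure X)
    (L : V →ₗ[ℝ] (X → ℝ)) (w : X → ℝ)
    (hint : ∀ u v, Integrable (fun x => w x * (L u x * L v x)) μ) :
    ∃ B : LinearMap.BilinForm ℝ V, ∀ v, B v v = ∫ x, w x * (L v x) ^ 2 ∂μ := by
  refine ⟨LinearMap.mk₂ ℝ (fun u v => ∫ x, w x * (L u x * L v x) ∂μ) ?_ ?_ ?_ ?_, ?_⟩
  · intro u v z
    rw [← integral_add (hint _ _) (hint _ _)]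
    congr 1; ext x; simp; ring
  · intro c u v
    rw [smul_eq_mul, ← integral_const_mul]
    congr 1; ext x; simp; ring
  · intro u v z
    rw [← integral_add (hint _ _) (hint _ _)]
    congr 1; ext x; simp; ring
  · intro c u v
    rw [smul_eq_mul, ← integral_const_mul]
    congr 1; ext x; simp; ring
  · intro v
    simp [pow_two]

lemma sq_int_pos {X : Type*} [TopologicalSpace X] [MeasurableSpace X] [BorelSpace X]
    (μ : Measure X) [μ.IsOpenPosMeasure] [IsFiniteMeasureOnCompacts μ]
    {f : X → ℝ} (hf : Continuous f) (hs : HasCompactSupport f) (h0 : f ≠ 0) :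
    0 < ∫ x, f x ^ 2 ∂μ := by
  obtain ⟨x, hx⟩ := Function.ne_iff.mp h0
  exact (hf.pow 2).integral_pos_of_hasCompactSupport_nonneg_nonzero (sq_cs hs)
    (fun x => sq_nonneg _) (x := x) (by simpa using hx)

lemma bdd2 (Ω : Set (ℝ × ℝ)) (F : Submodule ℝ ((ℝ × ℝ) → ℝ)) [FiniteDimensional ℝ F]
    (hF : ∀ ψ ∈ F, ContDiff ℝ (⊤ : ℕ∞) ψ ∧ HasCompactSupport ψ ∧ tsupport ψ ⊆ Ω) :
    BddAbove { s : ℝ | ∃ ψ ∈ F, ψ ≠ (0 : (ℝ × ℝ) → ℝ) ∧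
      s = (∫ p in Ω, gradSq ψ p) / (∫ p in Ω, (ψ p) ^ 2) } := by
  let LX : F →ₗ[ℝ] (ℝ × ℝ → ℝ) :=
    { toFun := fun ψ => dX ψ
      map_add' := fun ψ φ => by
        ext p
        have h1 := (hF _ ψ.2).1.differentiable (by simp) p
        have h2 := (hF _ φ.2).1.differentiable (by simp) p
        simp [dX, fderiv_add h1 h2]
      map_smul' := fun c ψ => by
        ext p
        have h1 := (hF _ ψ.2).1.differentiable (by simp) p
        simp [dX, fderiv_const_smul h1] }
  let LY : F →ₗ[ℝ] (ℝ × ℝ → ℝ) :=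
    { toFun := fun ψ => dY ψ
      map_add' := fun ψ φ => by
        ext p
        have h1 := (hF _ ψ.2).1.differentiable (by simp) p
        have h2 := (hF _ φ.2).1.differentiable (by simp) p
        simp [dY, fderiv_add h1 h2]
      map_smul' := fun c ψ => by
        ext p
        have h1 := (hF _ ψ.2).1.differentiable (by simp) p
        simp [dY, fderiv_const_smul h1] }
  have ci : ∀ f g : ℝ × ℝ → ℝ, Continuous f → Continuous g → HasCompactSupport f →
      Integrable (fun x => (1:ℝ) * (f x * g x)) := fun f g hf hg hs =>
    (continuous_const.mul (hf.mul hg)).integrable_of_hasCompactSupport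
      ((hs.mul_right (f' := g)).mul_left (f := fun _ => (1:ℝ)))
  obtain ⟨BX, hBX⟩ := quad_bilin volume LX (fun _ => 1) fun u v =>
    ci _ _ (dX_smooth (hF _ u.2).1).continuous (dX_smooth (hF _ v.2).1).continuous (dX_cs (hF _ u.2).2.1)
  obtain ⟨BY, hBY⟩ := quad_bilin volume LY (fun _ => 1) fun u v =>
    ci _ _ (dY_smooth (hF _ u.2).1).continuous (dY_smooth (hF _ v.2).1).continuous (dY_cs (hF _ u.2).2.1)
  obtain ⟨BD, hBD⟩ := quad_bilin volume F.subtype (fun _ => 1) fun u v =>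
    ci _ _ (hF _ u.2).1.continuous (hF _ v.2).1.continuous (hF _ u.2).2.1
  obtain ⟨C, hC⟩ := ratio_bdd (BX + BY) BD fun v hv => by
    rw [hBD]
    simp only [one_mul]
    exact sq_int_pos volume (hF _ v.2).1.continuous (hF _ v.2).2.1 (by simpa using hv)
  refine ⟨C, ?_⟩
  rintro s ⟨ψ, hψ, h0, rfl⟩
  have := hC ⟨ψ, hψ⟩ (by simpa using h0)
  obtain ⟨h1, h2, h3⟩ := hF ψ hψ
  rw [setInt_sq h3, setInt_grad h1 h3, integral_add]
  · simp only [LinearMap.add_apply, hBX, hBY, hBD, one_mul] at this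
    exact this
  · exact ((dX_smooth h1).continuous.pow 2).integrable_of_hasCompactSupport (sq_cs (dX_cs h2))
  · exact ((dY_smooth h1).continuous.pow 2).integrable_of_hasCompactSupport (sq_cs (dY_cs h2))

lemma deriv_smooth1 {f : ℝ → ℝ} (h : ContDiff ℝ (⊤ : ℕ∞) f) : ContDiff ℝ (⊤ : ℕ∞) (deriv f) :=
  (contDiff_infty_iff_deriv.mp h).2
lemma diff1 {f : ℝ → ℝ} (h : ContDiff ℝ (⊤ : ℕ∞) f) : Differentiable ℝ f :=
  (contDiff_infty_iff_deriv.mp h).1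

lemma bdd1 (q : ℝ → ℝ) (hq : Continuous q) (F : Submodule ℝ (ℝ → ℝ)) [FiniteDimensional ℝ F]
    (hF : ∀ χ ∈ F, ContDiff ℝ (⊤ : ℕ∞) χ ∧ HasCompactSupport χ) :
    BddAbove { s : ℝ | ∃ χ ∈ F, χ ≠ (0 : ℝ → ℝ) ∧
      s = (∫ x : ℝ, (deriv χ x ^ 2 + q x * χ x ^ 2)) / (∫ x : ℝ, χ x ^ 2) } := by
  let LX : F →ₗ[ℝ] (ℝ → ℝ) :=
    { toFun := fun ψ => deriv ψ
      map_add' := fun ψ φ => by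
        ext p
        have h1 := diff1 (hF _ ψ.2).1 p
        have h2 := diff1 (hF _ φ.2).1 p
        simp [deriv_add h1 h2]
      map_smul' := fun c ψ => by
        ext p
        have h1 := diff1 (hF _ ψ.2).1 p
        simp [deriv_const_smul c h1] }
  have ci : ∀ w f g : ℝ → ℝ, Continuous w → Continuous f → Continuous g → HasCompactSupport f →
      Integrable (fun x => w x * (f x * g x)) := fun w f g hw hf hg hs =>
    (hw.mul (hf.mul hg)).integrable_of_hasCompactSupport
      ((hs.mul_right (f' := g)).mul_left (f := w))
  obtain ⟨BX, hBX⟩ := quad_bilin volume LX (fun _ => 1) fun u v =>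
    ci _ _ _ continuous_const (deriv_smooth1 (hF _ u.2).1).continuous (deriv_smooth1 (hF _ v.2).1).continuous (hF _ u.2).2.deriv
  obtain ⟨BY, hBY⟩ := quad_bilin volume F.subtype q fun u v =>
    ci _ _ _ hq (hF _ u.2).1.continuous (hF _ v.2).1.continuous (hF _ u.2).2
  obtain ⟨BD, hBD⟩ := quad_bilin volume F.subtype (fun _ => 1) fun u v =>
    ci _ _ _ continuous_const (hF _ u.2).1.continuous (hF _ v.2).1.continuous (hF _ u.2).2
  obtain ⟨C, hC⟩ := ratio_bdd (BX + BY) BD fun v hv => by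
    rw [hBD]
    simp only [one_mul]
    exact sq_int_pos volume (hF _ v.2).1.continuous (hF _ v.2).2 (by simpa using hv)
  refine ⟨C, ?_⟩
  rintro s ⟨ψ, hψ, h0, rfl⟩
  have := hC ⟨ψ, hψ⟩ (by simpa using h0)
  obtain ⟨h1, h2⟩ := hF ψ hψ
  rw [integral_add]
  · simp only [LinearMap.add_apply, hBX, hBY, hBD, one_mul] at this
    exact this
  · exact ((deriv_smooth1 h1).continuous.pow 2).integrable_of_hasCompactSupport (sq_cs h2.deriv)
  · exact (hq.mul (h1.continuous.pow 2)).integrable_of_hasCompactSupport ((sq_cs h2).mul_left (f := q))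

lemma st_deriv_bdd : ∃ C > 0, ∀ x, |deriv Real.smoothTransition x| ≤ C := by
  have hc : Continuous (deriv Real.smoothTransition) :=
    (deriv_smooth1 (Real.smoothTransition.contDiff (n := (⊤ : ℕ∞)))).continuous
  obtain ⟨C, hC⟩ := (isCompact_Icc (a := (0:ℝ)) (b := 1)).exists_bound_of_continuousOn hc.continuousOn
  refine ⟨max C 1, by positivity, fun x => ?_⟩
  by_cases hx : x ∈ Icc (0:ℝ) 1
  · exact (hC x hx).trans (le_max_left _ _)
  · have : deriv Real.smoothTransition x = 0 := by
      rcases not_and_or.mp hx with h | h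
      · have : Real.smoothTransition =ᶠ[nhds x] fun _ => 0 := by
          filter_upwards [Iio_mem_nhds (not_le.mp h)] with y hy
          exact Real.smoothTransition.zero_of_nonpos hy.le
        rw [this.deriv_eq]; simp
      · have : Real.smoothTransition =ᶠ[nhds x] fun _ => 1 := by
          filter_upwards [Ioi_mem_nhds (not_le.mp h)] with y hy
          exact Real.smoothTransition.one_of_one_le hy.le
        rw [this.deriv_eq]; simp
    rw [this, abs_zero]; positivity

lemma st_hasDeriv (x : ℝ) : HasDerivAt Real.smoothTransition (deriv Real.smoothTransition x) x :=
  (diff1 (Real.smoothTransition.contDiff (n := (⊤ : ℕ∞))) x).hasDerivAt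

lemma exists_cutoff : ∃ C > 0, ∀ R > 0, ∃ η : ℝ → ℝ, ContDiff ℝ (⊤ : ℕ∞) η ∧
    (∀ t, 0 ≤ η t) ∧ (∀ t, η t ≤ 1) ∧ (∀ t, |t| ≤ R → η t = 1) ∧
    (∀ t, 2 * R ≤ |t| → η t = 0) ∧ (∀ t, |deriv η t| ≤ C / R) := by
  obtain ⟨C, hC, hb⟩ := st_deriv_bdd
  refine ⟨2 * C, by positivity, fun R hR => ?_⟩
  set S := Real.smoothTransition with hS
  have hS0 : ∀ x, 0 ≤ S x := Real.smoothTransition.nonneg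
  have hS1 : ∀ x, S x ≤ 1 := Real.smoothTransition.le_one
  refine ⟨fun t => S (2 - t / R) * S (2 + t / R), ?_, ?_, ?_, ?_, ?_, ?_⟩
  · have hs : ContDiff ℝ ((⊤ : ℕ∞) : WithTop ℕ∞) S := Real.smoothTransition.contDiff
    exact (hs.comp (by fun_prop)).mul (hs.comp (by fun_prop))
  · exact fun t => mul_nonneg (hS0 _) (hS0 _)
  · exact fun t => mul_le_one₀ (hS1 _) (hS0 _) (hS1 _)
  · intro t ht
    have h1 := abs_le.mp ht
    have h2 : t / R ≤ 1 := by rw [div_le_one hR]; linarith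
    have h3 : -1 ≤ t / R := by rw [le_div_iff₀ hR]; linarith
    simp only
    rw [hS, Real.smoothTransition.one_of_one_le (by linarith), Real.smoothTransition.one_of_one_le (by linarith), one_mul]
  · intro t ht
    simp only
    rcases le_abs.mp ht with h | h
    · have h2 : 2 ≤ t / R := by rw [le_div_iff₀ hR]; linarith
      rw [hS, Real.smoothTransition.zero_of_nonpos (x := 2 - t / R) (by linarith), zero_mul]
    · have h2 : t / R ≤ -2 := by rw [div_le_iff₀ hR]; linarith
      rw [hS, Real.smoothTransition.zero_of_nonpos (x := 2 + t / R) (by linarith), mul_zero]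
  · intro t
    have d1 : HasDerivAt (fun t => 2 - t / R) (-(1 / R)) t := by
      simpa using ((hasDerivAt_id t).div_const R).const_sub 2
    have d2 : HasDerivAt (fun t => 2 + t / R) (1 / R) t := by
      simpa using ((hasDerivAt_id t).div_const R).const_add 2
    have d3 := ((st_hasDeriv (2 - t / R)).comp t d1).mul ((st_hasDeriv (2 + t / R)).comp t d2)
    have d4 : deriv (fun t => S (2 - t / R) * S (2 + t / R)) t = _ := d3.deriv
    rw [d4]
    simp only [Function.comp_apply]
    have e1 := hb (2 - t / R)
    have e2 := hb (2 + t / R)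
    have hR' : 0 < 1 / R := by positivity
    refine (abs_add_le _ _).trans ?_
    rw [abs_mul, abs_mul, abs_mul, abs_mul, abs_neg, abs_of_pos hR', abs_of_nonneg (Real.smoothTransition.nonneg _), abs_of_nonneg (Real.smoothTransition.nonneg _)]
    have f1 : |deriv Real.smoothTransition (2 - t / R)| * (1 / R) * Real.smoothTransition (2 + t / R) ≤ C * (1 / R) * 1 := by
      gcongr
      · exact hS0 _
      · exact hS1 _
    have f2 : Real.smoothTransition (2 - t / R) * (|deriv Real.smoothTransition (2 + t / R)| * (1 / R)) ≤ 1 * (C * (1 / R)) := by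
      gcongr
      exact hS1 _
    calc _ ≤ C * (1 / R) * 1 + 1 * (C * (1 / R)) := add_le_add f1 f2
      _ = 2 * C / R := by ring

lemma lower1D (θ Λ Λ0 B R d : ℝ) (hθ : 0 < θ) (hθ2 : θ ≤ 1 / 2) (hΛ : Λ ≤ Λ0)
    (X N W q η : ℝ → ℝ) (hX : ContDiff ℝ (⊤ : ℕ∞) X) (hXs : HasCompactSupport X)
    (hN : Continuous N) (hNs : HasCompactSupport N) (hW : Continuous W) (hq : Continuous q)
    (hXN : ∀ t, X t ^ 2 ≤ N t) (hW0 : ∀ t, 0 ≤ W t) (hB : 1 / θ ≤ B)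
    (hη : ContDiff ℝ (⊤ : ℕ∞) η) (η0 : ∀ t, 0 ≤ η t) (η1 : ∀ t, η t ≤ 1)
    (ηR : ∀ t, |t| ≤ R → η t = 1) (η2R : ∀ t, 2 * R ≤ |t| → η t = 0)
    (ηd : ∀ t, |deriv η t| ≤ d) (hd : (1 + 1 / θ) * d ^ 2 ≤ θ)
    (hqW : ∀ t, |t| ≤ 2 * R → q t ≤ W t + θ) (hWR : ∀ t, R ≤ |t| → 1 / θ ≤ W t)
    (H : ∫ t, (deriv X t ^ 2 + (1 - θ) * W t * N t + B * (N t - X t ^ 2)) ≤ Λ * ∫ t, N t) :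
    (∫ t, (deriv (fun t => η t * X t) t ^ 2 + q t * (η t * X t) ^ 2)) ≤ (Λ + (4 * Λ0 + 2) * θ) * ∫ t, N t ∧
    (1 - 2 * θ * Λ0) * (∫ t, N t) ≤ ∫ t, (η t * X t) ^ 2 := by
  have hX'c := (deriv_smooth1 hX).continuous
  have hη'c := (deriv_smooth1 hη).continuous
  have hXc := hX.continuous
  have hηc := hη.continuous
  have hN0 : ∀ t, 0 ≤ N t := fun t => (sq_nonneg _).trans (hXN t)
  have hIN0 : 0 ≤ ∫ t, N t := integral_nonneg hN0
  have hIN : Integrable N := hN.integrable_of_hasCompactSupport hNs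
  set I : ℝ → ℝ := fun t => deriv X t ^ 2 + (1 - θ) * W t * N t + B * (N t - X t ^ 2) with hI
  have hIc : Integrable I := by
    refine (by fun_prop : Continuous I).integrable_of_hasCompactSupport ?_
    exact ((sq_cs hXs.deriv).add (hNs.mul_left (f := fun t => (1 - θ) * W t))).add
      ((hNs.sub (sq_cs hXs)).mul_left (f := fun _ => B))
  have hY : ∀ t, deriv (fun t => η t * X t) t = deriv η t * X t + η t * deriv X t := fun t =>
    ((diff1 hη t).hasDerivAt.mul (diff1 hX t).hasDerivAt).deriv
  have hYs : HasCompactSupport (fun t => η t * X t) := hXs.mul_left (f := η)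
  have hYsm : ContDiff ℝ (⊤ : ℕ∞) (fun t => η t * X t) := hη.mul hX
  have hBp : 0 < B := lt_of_lt_of_le (by positivity) hB
  have hWN : ∀ t, W t * X t ^ 2 ≤ W t * N t := fun t => mul_le_mul_of_nonneg_left (hXN t) (hW0 t)
  have hI0 : ∀ t, 0 ≤ (1 - θ) * W t * N t := fun t => by
    have := mul_nonneg (hW0 t) (hN0 t)
    rw [mul_assoc]; exact mul_nonneg (by linarith) this
  have hNX : ∀ t, 0 ≤ B * (N t - X t ^ 2) := fun t => mul_nonneg hBp.le (sub_nonneg.mpr (hXN t))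
  constructor
  · have p : ∀ t, deriv (fun t => η t * X t) t ^ 2 + q t * (η t * X t) ^ 2 ≤ (1 + 4 * θ) * I t + 2 * θ * N t := by
      intro t
      rw [hY t]
      have a1 : (deriv η t * X t + η t * deriv X t) ^ 2 ≤ (1 + 1 / θ) * (deriv η t * X t) ^ 2 + (1 + θ) * (η t * deriv X t) ^ 2 := by
        have : (1 + 1 / θ) * (deriv η t * X t) ^ 2 + (1 + θ) * (η t * deriv X t) ^ 2 - (deriv η t * X t + η t * deriv X t) ^ 2 = (deriv η t * X t - θ * (η t * deriv X t)) ^ 2 / θ := by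
          field_simp; ring
        have h2 : 0 ≤ (deriv η t * X t - θ * (η t * deriv X t)) ^ 2 / θ := by positivity
        linarith
      have a2 : (1 + 1 / θ) * (deriv η t * X t) ^ 2 ≤ θ * X t ^ 2 := by
        have : deriv η t ^ 2 ≤ d ^ 2 := by
          rw [← sq_abs]; exact pow_le_pow_left₀ (abs_nonneg _) (ηd t) 2
        calc (1 + 1 / θ) * (deriv η t * X t) ^ 2 = ((1 + 1 / θ) * deriv η t ^ 2) * X t ^ 2 := by ring
          _ ≤ ((1 + 1 / θ) * d ^ 2) * X t ^ 2 := by gcongr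
          _ ≤ θ * X t ^ 2 := by gcongr
      have η2 : η t ^ 2 ≤ 1 := pow_le_one₀ (η0 t) (η1 t)
      have a3 : (η t * deriv X t) ^ 2 ≤ deriv X t ^ 2 := by
        rw [mul_pow]; exact mul_le_of_le_one_left (sq_nonneg _) η2
      have a4 : q t * (η t * X t) ^ 2 ≤ (W t + θ) * X t ^ 2 := by
        by_cases ht : |t| ≤ 2 * R
        · calc q t * (η t * X t) ^ 2 ≤ (W t + θ) * (η t * X t) ^ 2 := by
                gcongr; exact hqW t ht
            _ ≤ (W t + θ) * X t ^ 2 := by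
                have := hW0 t
                refine mul_le_mul_of_nonneg_left ?_ (by linarith)
                rw [mul_pow]; exact mul_le_of_le_one_left (sq_nonneg _) η2
        · rw [η2R t (not_le.mp ht).le]
          have := hW0 t
          simp only [zero_mul, ne_eq, OfNat.ofNat_ne_zero, not_false_eq_true, zero_pow, mul_zero]
          positivity
      have a5 := mul_le_mul_of_nonneg_left a3 (by linarith : 0 ≤ 1 + θ)
      have a6 : W t * N t ≤ (1 + 4 * θ) * ((1 - θ) * W t * N t) := by
        have := mul_nonneg (hW0 t) (hN0 t)
        nlinarith [mul_nonneg hθ.le this]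
      have a7 : 0 ≤ (1 + 4 * θ) * (B * (N t - X t ^ 2)) := mul_nonneg (by linarith) (hNX t)
      have a8 : (1 + θ) * deriv X t ^ 2 ≤ (1 + 4 * θ) * deriv X t ^ 2 := by gcongr; linarith
      have a9 := mul_le_mul_of_nonneg_left (hXN t) (by linarith : 0 ≤ 2 * θ)
      have := hWN t
      simp only [hI]
      nlinarith
    have hint : Integrable (fun t => deriv (fun t => η t * X t) t ^ 2 + q t * (η t * X t) ^ 2) := by
      refine Continuous.integrable_of_hasCompactSupport ?_ ((sq_cs hYs.deriv).add ((sq_cs hYs).mul_left (f := q)))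
      exact ((deriv_smooth1 hYsm).continuous.pow 2).add (hq.mul (hYsm.continuous.pow 2))
    calc _ ≤ ∫ t, ((1 + 4 * θ) * I t + 2 * θ * N t) :=
          integral_mono hint ((hIc.const_mul _).add (hIN.const_mul _)) p
      _ = (1 + 4 * θ) * (∫ t, I t) + 2 * θ * ∫ t, N t := by
          rw [integral_add (hIc.const_mul _) (hIN.const_mul _), integral_const_mul, integral_const_mul]
      _ ≤ (1 + 4 * θ) * (Λ * ∫ t, N t) + 2 * θ * ∫ t, N t := by gcongr
      _ ≤ _ := by
          have : θ * Λ * (∫ t, N t) ≤ θ * Λ0 * ∫ t, N t := by gcongr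
          nlinarith
  · have p : ∀ t, N t ≤ (η t * X t) ^ 2 + 2 * θ * I t := by
      intro t
      have b1 : N t - X t ^ 2 ≤ θ * (B * (N t - X t ^ 2)) := by
        have : 1 ≤ θ * B := by
          have := mul_le_mul_of_nonneg_left hB hθ.le
          rwa [mul_one_div_cancel hθ.ne'] at this
        nlinarith [hXN t]
      have b2 : X t ^ 2 ≤ (η t * X t) ^ 2 + θ * (W t * X t ^ 2) := by
        by_cases ht : |t| ≤ R
        · rw [ηR t ht, one_mul]
          have := mul_nonneg hθ.le (mul_nonneg (hW0 t) (sq_nonneg (X t)))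
          linarith
        · have h1 := hWR t (not_le.mp ht).le
          have : 1 ≤ θ * W t := by
            have := mul_le_mul_of_nonneg_left h1 hθ.le
            rwa [mul_one_div_cancel hθ.ne'] at this
          nlinarith [sq_nonneg (X t), sq_nonneg (η t * X t)]
      have b3 : W t * N t ≤ 2 * ((1 - θ) * W t * N t) := by
        have := mul_nonneg (hW0 t) (hN0 t)
        nlinarith
      have b4 := mul_le_mul_of_nonneg_left ((hWN t).trans b3) hθ.le
      have b5 := mul_nonneg hθ.le (hNX t)
      have b6 := mul_nonneg hθ.le (sq_nonneg (deriv X t))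
      simp only [hI]
      nlinarith
    have hYi : Integrable (fun t => (η t * X t) ^ 2) :=
      (hYsm.continuous.pow 2).integrable_of_hasCompactSupport (sq_cs hYs)
    have := integral_mono hIN (hYi.add (hIc.const_mul (2 * θ))) p
    simp only [Pi.add_apply] at this
    rw [integral_add hYi (hIc.const_mul _), integral_const_mul] at this
    have h2 : 2 * θ * (∫ t, I t) ≤ 2 * θ * (Λ * ∫ t, N t) := by gcongr
    have h3 : θ * Λ * (∫ t, N t) ≤ θ * Λ0 * ∫ t, N t := by gcongr
    nlinarith

lemma int_restrict (F : ℝ → ℝ) (l : ℝ) (hl : 0 ≤ l) (h : ∀ y, ¬ (0 < y ∧ y < l) → F y = 0) :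
    ∫ y, F y = ∫ y in (0:ℝ)..l, F y := by
  rw [intervalIntegral.integral_of_le hl]
  symm
  refine setIntegral_eq_integral_of_forall_compl_eq_zero fun y hy => h y fun hh => hy ?_
  exact ⟨hh.1, hh.2.le⟩

section lower
variable {h : ℝ → ℝ} {ε : ℝ} {ψ : ℝ × ℝ → ℝ}

noncomputable def modeF (l : ℝ) (y : ℝ) : ℝ := Real.sqrt (2 / l) * Real.sin (π / l * y)

lemma modeF_cont (l : ℝ) : Continuous (modeF l) := by unfold modeF; fun_prop

lemma PI_modeF_sq (f : ℝ × ℝ → ℝ) (l x : ℝ) (hl : 0 < l)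
    (hz : ∀ y, ¬ (0 < y ∧ y < l) → f (x, y) = 0) :
    PI f (modeF l) x ^ 2 = (2 / l) * (∫ y in (0:ℝ)..l, f (x, y) * Real.sin (π / l * y)) ^ 2 := by
  have h1 : PI f (modeF l) x = Real.sqrt (2 / l) * ∫ y in (0:ℝ)..l, f (x, y) * Real.sin (π / l * y) := by
    unfold PI
    rw [int_restrict _ l hl.le (fun y hy => by rw [hz y hy, zero_mul]), ← intervalIntegral.integral_const_mul]
    congr 1; ext y; unfold modeF; ring
  rw [h1, mul_pow, Real.sq_sqrt (by positivity)]

lemma PI_one_sq (f : ℝ × ℝ → ℝ) (l x : ℝ) (hl : 0 ≤ l)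
    (hz : ∀ y, ¬ (0 < y ∧ y < l) → f (x, y) = 0) :
    PI (fun p => f p ^ 2) (fun _ => 1) x = ∫ y in (0:ℝ)..l, f (x, y) ^ 2 := by
  unfold PI
  rw [int_restrict _ l hl (fun y hy => by simp [hz y hy])]
  simp

lemma slice_ineq (hpos : ∀ x, 0 < h x) (hle : ∀ x, h x ≤ h 0) (hε : 0 < ε)
    (hψ : ContDiff ℝ (⊤ : ℕ∞) ψ) (hs : HasCompactSupport ψ)
    (hΩ : tsupport ψ ⊆ {p : ℝ × ℝ | 0 < p.2 ∧ p.2 < ε * h p.1}) (x : ℝ) :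
    (π / (ε * h x)) ^ 2 * PI (fun p => ψ p ^ 2) (fun _ => 1) x ≤ PI (fun p => dY ψ p ^ 2) (fun _ => 1) x ∧
    (π / (ε * h 0)) ^ 2 * (4 * PI (fun p => ψ p ^ 2) (fun _ => 1) x - 3 * PI ψ (modeF (ε * h 0)) x ^ 2)
      ≤ PI (fun p => dY ψ p ^ 2) (fun _ => 1) x ∧
    PI ψ (modeF (ε * h 0)) x ^ 2 ≤ PI (fun p => ψ p ^ 2) (fun _ => 1) x ∧
    deriv (PI ψ (modeF (ε * h 0))) x ^ 2 ≤ PI (fun p => dX ψ p ^ 2) (fun _ => 1) x := by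
  have hl : 0 < ε * h x := mul_pos hε (hpos x)
  have hL : 0 < ε * h 0 := mul_pos hε (hpos 0)
  have hlL : ε * h x ≤ ε * h 0 := mul_le_mul_of_nonneg_left (hle x) hε.le
  have zz : ∀ f : ℝ × ℝ → ℝ, tsupport f ⊆ tsupport ψ → ∀ y, ¬ (0 < y ∧ y < ε * h x) → f (x, y) = 0 := by
    intro f hf y hy
    exact image_eq_zero_of_notMem_tsupport fun hh => hy (hΩ (hf hh))
  have zL : ∀ f : ℝ × ℝ → ℝ, tsupport f ⊆ tsupport ψ → ∀ y, ¬ (0 < y ∧ y < ε * h 0) → f (x, y) = 0 :=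
    fun f hf y hy => zz f hf y fun hh => hy ⟨hh.1, hh.2.trans_le hlL⟩
  have hYc : Continuous (dY ψ) := (dY_smooth hψ).continuous
  have hXc : Continuous (dX ψ) := (dX_smooth hψ).continuous
  have hψc : Continuous ψ := hψ.continuous
  refine ⟨?_, ?_, ?_, ?_⟩
  · rw [PI_one_sq ψ _ x hl.le (zz ψ subset_rfl), PI_one_sq (dY ψ) _ x hl.le (zz _ (tsupport_dY_sub ψ))]
    have := poincare (fun y => ψ (x, y)) (fun y => dY ψ (x, y)) (fun y => hasDerivAt_sliceY hψ x y)
      (by fun_prop) 0 (ε * h x) hl (zz ψ subset_rfl 0 (by simp)) (zz ψ subset_rfl _ (by simp))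
    simpa using this
  · rw [PI_one_sq ψ _ x hL.le (zL ψ subset_rfl), PI_one_sq (dY ψ) _ x hL.le (zL _ (tsupport_dY_sub ψ)),
      PI_modeF_sq ψ _ x hL (zL ψ subset_rfl)]
    exact gap (fun y => ψ (x, y)) (fun y => dY ψ (x, y)) (fun y => hasDerivAt_sliceY hψ x y)
      (by fun_prop) (ε * h 0) hL (zL ψ subset_rfl 0 (by simp)) (zL ψ subset_rfl _ (by simp))
  · rw [PI_one_sq ψ _ x hL.le (zL ψ subset_rfl), PI_modeF_sq ψ _ x hL (zL ψ subset_rfl)]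
    exact bessel (fun y => ψ (x, y)) (by fun_prop) _ hL
  · rw [PI_deriv hψ hs (modeF_cont _), PI_one_sq (dX ψ) _ x hL.le (zL _ (tsupport_dX_sub ψ)),
      PI_modeF_sq (dX ψ) _ x hL (zL _ (tsupport_dX_sub ψ))]
    exact bessel (fun y => dX ψ (x, y)) (by fun_prop) _ hL

lemma energy_eq {Ω : Set (ℝ × ℝ)} (hψ : ContDiff ℝ (⊤ : ℕ∞) ψ) (hs : HasCompactSupport ψ) (hΩ : tsupport ψ ⊆ Ω) :
    ∫ p in Ω, gradSq ψ p = (∫ x, PI (fun p => dX ψ p ^ 2) (fun _ => 1) x) +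
      ∫ x, PI (fun p => dY ψ p ^ 2) (fun _ => 1) x := by
  have hX := sq_smooth (dX_smooth hψ)
  have hY := sq_smooth (dY_smooth hψ)
  have hXs := sq_cs (dX_cs hs)
  have hYs := sq_cs (dY_cs hs)
  rw [setInt_grad hψ hΩ, integral_add (hX.continuous.integrable_of_hasCompactSupport hXs)
    (hY.continuous.integrable_of_hasCompactSupport hYs), integral_eq_PI hX.continuous hXs,
    integral_eq_PI hY.continuous hYs]

lemma mass_eq {Ω : Set (ℝ × ℝ)} (hψ : ContDiff ℝ (⊤ : ℕ∞) ψ) (hs : HasCompactSupport ψ) (hΩ : tsupport ψ ⊆ Ω) :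
    ∫ p in Ω, ψ p ^ 2 = ∫ x, PI (fun p => ψ p ^ 2) (fun _ => 1) x := by
  rw [setInt_sq hΩ, integral_eq_PI (sq_smooth hψ).continuous (sq_cs hs)]

lemma scale_cs {f : ℝ → ℝ} (hf : HasCompactSupport f) {β : ℝ} (hβ : 0 < β) :
    HasCompactSupport fun t => f (β * t) :=
  hf.comp_homeomorph (Homeomorph.mulLeft₀ β hβ.ne')

lemma lower2D (hcont : Continuous h) (hpos : ∀ x, 0 < h x) (hle : ∀ x, h x ≤ h 0) (hε : 0 < ε)
    (hψ : ContDiff ℝ (⊤ : ℕ∞) ψ) (hs : HasCompactSupport ψ)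
    (hΩ : tsupport ψ ⊆ {p : ℝ × ℝ | 0 < p.2 ∧ p.2 < ε * h p.1}) (β θ : ℝ) (hβ : 0 < β)
    (hθ : 0 < θ) (hθ2 : θ ≤ 1 / 2) :
    let X : ℝ → ℝ := fun t => PI ψ (modeF (ε * h 0)) (β * t)
    let N : ℝ → ℝ := fun t => PI (fun p => ψ p ^ 2) (fun _ => 1) (β * t)
    let W : ℝ → ℝ := fun t => β ^ 2 * ((π / (ε * h (β * t))) ^ 2 - (π / (ε * h 0)) ^ 2)
    (∫ t, (deriv X t ^ 2 + (1 - θ) * W t * N t + (3 * θ * β ^ 2 * (π / (ε * h 0)) ^ 2) * (N t - X t ^ 2)))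
      ≤ β * ((∫ p in {p : ℝ × ℝ | 0 < p.2 ∧ p.2 < ε * h p.1}, gradSq ψ p) -
        (π / (ε * h 0)) ^ 2 * ∫ p in {p : ℝ × ℝ | 0 < p.2 ∧ p.2 < ε * h p.1}, ψ p ^ 2) ∧
    ∫ t, N t = β⁻¹ * ∫ p in {p : ℝ × ℝ | 0 < p.2 ∧ p.2 < ε * h p.1}, ψ p ^ 2 := by
  intro X N W
  set a := PI ψ (modeF (ε * h 0)) with ha
  set n := PI (fun p => ψ p ^ 2) (fun _ => 1) with hn
  set ex := PI (fun p => dX ψ p ^ 2) (fun _ => 1) with hex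
  set ey := PI (fun p => dY ψ p ^ 2) (fun _ => 1) with hey
  have hasm : ContDiff ℝ (⊤ : ℕ∞) a := PI_smooth hψ hs (modeF_cont _)
  have hacs : HasCompactSupport a := PI_cs hs _
  have hnc : Continuous n := (PI_smooth (sq_smooth hψ) (sq_cs hs) continuous_const).continuous
  have hncs : HasCompactSupport n := PI_cs (sq_cs hs) _
  have hexc : Continuous ex := (PI_smooth (sq_smooth (dX_smooth hψ)) (sq_cs (dX_cs hs)) continuous_const).continuous
  have hexcs : HasCompactSupport ex := PI_cs (sq_cs (dX_cs hs)) _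
  have heyc : Continuous ey := (PI_smooth (sq_smooth (dY_smooth hψ)) (sq_cs (dY_cs hs)) continuous_const).continuous
  have heycs : HasCompactSupport ey := PI_cs (sq_cs (dY_cs hs)) _
  have hXd : ∀ t, deriv X t = β * deriv a (β * t) := by
    intro t
    have h1 : HasDerivAt (fun t => β * t) β t := by simpa using (hasDerivAt_id t).const_mul β
    have := ((diff1 hasm (β * t)).hasDerivAt.comp t h1).deriv
    rw [mul_comm]
    exact this
  have hXsm : ContDiff ℝ (⊤ : ℕ∞) X := hasm.comp (by fun_prop)
  have hXcs : HasCompactSupport X := scale_cs hacs hβ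
  have hNc : Continuous N := hnc.comp (by fun_prop)
  have hNcs : HasCompactSupport N := scale_cs hncs hβ
  have hWc : Continuous W := by
    have : ∀ t, ε * h (β * t) ≠ 0 := fun t => (mul_pos hε (hpos _)).ne'
    have h2 : Continuous fun t => π / (ε * h (β * t)) := Continuous.div (by fun_prop) (by fun_prop) this
    fun_prop
  have hX'c := (deriv_smooth1 hXsm).continuous
  have hXc := hXsm.continuous
  constructor
  · set V0 := (π / (ε * h 0)) ^ 2 with hV0
    have p : ∀ t, deriv X t ^ 2 + (1 - θ) * W t * N t + (3 * θ * β ^ 2 * V0) * (N t - X t ^ 2) ≤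
        β ^ 2 * (ex (β * t) + ey (β * t) - V0 * n (β * t)) := by
      intro t
      obtain ⟨s1, s2, s3, s4⟩ := slice_ineq hpos hle hε hψ hs hΩ (β * t)
      rw [hXd t]
      have : deriv a (β * t) ^ 2 + (1 - θ) * ((π / (ε * h (β * t))) ^ 2 - V0) * n (β * t) + 3 * θ * V0 * (n (β * t) - a (β * t) ^ 2) ≤ ex (β * t) + ey (β * t) - V0 * n (β * t) := by
        have t1 := mul_le_mul_of_nonneg_left s1 (by linarith : 0 ≤ 1 - θ)
        have t2 := mul_le_mul_of_nonneg_left s2 hθ.le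
        nlinarith
      have := mul_le_mul_of_nonneg_left this (sq_nonneg β)
      simp only [W, N, X]
      calc _ = _ := by ring
        _ ≤ _ := this
    have hi1 : Integrable (fun t => deriv X t ^ 2 + (1 - θ) * W t * N t + (3 * θ * β ^ 2 * V0) * (N t - X t ^ 2)) := by
      refine Continuous.integrable_of_hasCompactSupport (by fun_prop) ?_
      exact ((sq_cs hXcs.deriv).add (hNcs.mul_left (f := fun t => (1 - θ) * W t))).add
        ((hNcs.sub (sq_cs hXcs)).mul_left (f := fun _ => (3 * θ * β ^ 2 * V0)))
    have iex := hexc.integrable_of_hasCompactSupport hexcs (μ := volume)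
    have iey := heyc.integrable_of_hasCompactSupport heycs (μ := volume)
    have inn := hnc.integrable_of_hasCompactSupport hncs (μ := volume)
    have hi2 : Integrable (fun t => β ^ 2 * (ex (β * t) + ey (β * t) - V0 * n (β * t))) := by
      have : Integrable (fun x => ex x + ey x - V0 * n x) := (iex.add iey).sub (inn.const_mul V0)
      exact (this.comp_mul_left' hβ.ne').const_mul _
    refine (integral_mono hi1 hi2 p).trans (le_of_eq ?_)
    have e3 : ∫ x, (ex x + ey x - V0 * n x) = (∫ x, ex x) + (∫ x, ey x) - V0 * ∫ x, n x := by
      have := integral_sub (iex.add iey) (inn.const_mul V0)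
      simp only [Pi.add_apply] at this
      rw [this, integral_add iex iey, integral_const_mul]
    rw [integral_const_mul, Measure.integral_comp_mul_left (fun x => ex x + ey x - V0 * n x) β,
      energy_eq hψ hs hΩ, mass_eq hψ hs hΩ, e3, abs_of_pos (inv_pos.mpr hβ), smul_eq_mul]
    field_simp
    rfl
  · simp only [N]
    rw [Measure.integral_comp_mul_left n β, mass_eq hψ hs hΩ, abs_of_pos (inv_pos.mpr hβ), smul_eq_mul]

end lower

lemma fd_of_finrank {V : Type*} [AddCommGroup V] [Module ℝ V] {j : ℕ} (hj : 1 ≤ j)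
    (h : Module.finrank ℝ V = j) : FiniteDimensional ℝ V :=
  FiniteDimensional.of_finrank_pos (by omega)

lemma exists_ne_of_finrank {X : Type*} {F : Submodule ℝ (X → ℝ)} {j : ℕ} (hj : 1 ≤ j)
    (h : Module.finrank ℝ F = j) : ∃ ψ ∈ F, ψ ≠ 0 := by
  by_contra hh
  push Not at hh
  have : F = ⊥ := (Submodule.eq_bot_iff F).mpr hh
  subst this
  simp at h
  omega

lemma schr_bddBelow (q : ℝ → ℝ) (hq0 : ∀ x, 0 ≤ q x) (j : ℕ) :
    ∀ r ∈ { r : ℝ | ∃ F : Submodule ℝ (ℝ → ℝ),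
    Module.finrank ℝ F = j ∧
    (∀ χ ∈ F, ContDiff ℝ (⊤ : ℕ∞) χ ∧ HasCompactSupport χ) ∧
    r = sSup { s : ℝ | ∃ χ ∈ F, χ ≠ (0 : ℝ → ℝ) ∧
      s = (∫ x : ℝ, (deriv χ x ^ 2 + q x * χ x ^ 2)) / (∫ x : ℝ, χ x ^ 2) } }, 0 ≤ r := by
  rintro r ⟨F, -, -, rfl⟩
  apply Real.sSup_nonneg
  rintro s ⟨χ, -, -, rfl⟩
  apply div_nonneg
  · exact integral_nonneg fun x => add_nonneg (sq_nonneg _) (mul_nonneg (hq0 x) (sq_nonneg _))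
  · exact integral_nonneg fun x => sq_nonneg _

lemma dir_bddBelow (Ω : Set (ℝ × ℝ)) (j : ℕ) :
    ∀ r ∈ { r : ℝ | ∃ F : Submodule ℝ ((ℝ × ℝ) → ℝ),
    Module.finrank ℝ F = j ∧
    (∀ ψ ∈ F, ContDiff ℝ (⊤ : ℕ∞) ψ ∧ HasCompactSupport ψ ∧ tsupport ψ ⊆ Ω) ∧
    r = sSup { s : ℝ | ∃ ψ ∈ F, ψ ≠ (0 : (ℝ × ℝ) → ℝ) ∧
      s = (∫ p in Ω, gradSq ψ p) / (∫ p in Ω, (ψ p) ^ 2) } }, 0 ≤ r := by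
  rintro r ⟨F, -, -, rfl⟩
  apply Real.sSup_nonneg
  rintro s ⟨χ, -, -, rfl⟩
  apply div_nonneg
  · exact integral_nonneg fun x => add_nonneg (sq_nonneg _) (sq_nonneg _)
  · exact integral_nonneg fun x => sq_nonneg _

lemma schr_nonneg (q : ℝ → ℝ) (hq0 : ∀ x, 0 ≤ q x) (j : ℕ) : 0 ≤ schroedingerMinMax q j :=
  Real.sInf_nonneg (schr_bddBelow q hq0 j)

lemma schr_le (q : ℝ → ℝ) (hq0 : ∀ x, 0 ≤ q x) {j : ℕ} (hj : 1 ≤ j)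
    (G : Submodule ℝ (ℝ → ℝ)) (hG : Module.finrank ℝ G = j)
    (hG2 : ∀ χ ∈ G, ContDiff ℝ (⊤ : ℕ∞) χ ∧ HasCompactSupport χ) (r : ℝ)
    (hr : ∀ χ ∈ G, χ ≠ 0 → (∫ x : ℝ, (deriv χ x ^ 2 + q x * χ x ^ 2)) ≤ r * ∫ x : ℝ, χ x ^ 2) :
    schroedingerMinMax q j ≤ r := by
  refine (csInf_le ⟨0, schr_bddBelow q hq0 j⟩ ⟨G, hG, hG2, rfl⟩).trans (csSup_le ?_ ?_)
  · obtain ⟨ψ, h1, h2⟩ := exists_ne_of_finrank hj hG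
    exact ⟨_, ψ, h1, h2, rfl⟩
  · rintro s ⟨χ, h1, h2, rfl⟩
    rw [div_le_iff₀ (sq_int_pos volume (hG2 χ h1).1.continuous (hG2 χ h1).2 h2)]
    exact hr χ h1 h2

lemma mass_pos {Ω : Set (ℝ × ℝ)} {ψ : ℝ × ℝ → ℝ} (h : ContDiff ℝ (⊤ : ℕ∞) ψ ∧ HasCompactSupport ψ ∧ tsupport ψ ⊆ Ω)
    (h0 : ψ ≠ 0) : 0 < ∫ p in Ω, ψ p ^ 2 := by
  rw [setInt_sq h.2.2]
  exact sq_int_pos volume h.1.continuous h.2.1 h0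

lemma dir_le (Ω : Set (ℝ × ℝ)) {j : ℕ} (hj : 1 ≤ j)
    (F : Submodule ℝ ((ℝ × ℝ) → ℝ)) (hF : Module.finrank ℝ F = j)
    (hF2 : ∀ ψ ∈ F, ContDiff ℝ (⊤ : ℕ∞) ψ ∧ HasCompactSupport ψ ∧ tsupport ψ ⊆ Ω) (r : ℝ)
    (hr : ∀ ψ ∈ F, ψ ≠ 0 → (∫ p in Ω, gradSq ψ p) ≤ r * ∫ p in Ω, ψ p ^ 2) :
    dirichletMinMax Ω j ≤ r := by
  refine (csInf_le ⟨0, dir_bddBelow Ω j⟩ ⟨F, hF, hF2, rfl⟩).trans (csSup_le ?_ ?_)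
  · obtain ⟨ψ, h1, h2⟩ := exists_ne_of_finrank hj hF
    exact ⟨_, ψ, h1, h2, rfl⟩
  · rintro s ⟨χ, h1, h2, rfl⟩
    rw [div_le_iff₀ (mass_pos (hF2 χ h1) h2)]
    exact hr χ h1 h2

lemma ray_le_2D (Ω : Set (ℝ × ℝ)) {j : ℕ} (hj : 1 ≤ j)
    (F : Submodule ℝ ((ℝ × ℝ) → ℝ)) (hF : Module.finrank ℝ F = j)
    (hF2 : ∀ ψ ∈ F, ContDiff ℝ (⊤ : ℕ∞) ψ ∧ HasCompactSupport ψ ∧ tsupport ψ ⊆ Ω) (r : ℝ)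
    (hr : r = sSup { s : ℝ | ∃ ψ ∈ F, ψ ≠ (0 : (ℝ × ℝ) → ℝ) ∧
      s = (∫ p in Ω, gradSq ψ p) / (∫ p in Ω, (ψ p) ^ 2) }) (ψ : ℝ × ℝ → ℝ) (hψ : ψ ∈ F) (h0 : ψ ≠ 0) :
    (∫ p in Ω, gradSq ψ p) ≤ r * ∫ p in Ω, ψ p ^ 2 := by
  haveI := fd_of_finrank hj hF
  rw [← div_le_iff₀ (mass_pos (hF2 ψ hψ) h0), hr]
  exact le_csSup (bdd2 Ω F hF2) ⟨ψ, hψ, h0, rfl⟩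

lemma ray_le_1D (q : ℝ → ℝ) (hq : Continuous q) {j : ℕ} (hj : 1 ≤ j)
    (G : Submodule ℝ (ℝ → ℝ)) (hG : Module.finrank ℝ G = j)
    (hG2 : ∀ χ ∈ G, ContDiff ℝ (⊤ : ℕ∞) χ ∧ HasCompactSupport χ) (r : ℝ)
    (hr : r = sSup { s : ℝ | ∃ χ ∈ G, χ ≠ (0 : ℝ → ℝ) ∧
      s = (∫ x : ℝ, (deriv χ x ^ 2 + q x * χ x ^ 2)) / (∫ x : ℝ, χ x ^ 2) }) (χ : ℝ → ℝ) (hχ : χ ∈ G) (h0 : χ ≠ 0) :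
    (∫ x : ℝ, (deriv χ x ^ 2 + q x * χ x ^ 2)) ≤ r * ∫ x : ℝ, χ x ^ 2 := by
  haveI := fd_of_finrank hj hG
  rw [← div_le_iff₀ (sq_int_pos volume (hG2 χ hχ).1.continuous (hG2 χ hχ).2 h0), hr]
  exact le_csSup (bdd1 q hq G hG2) ⟨χ, hχ, h0, rfl⟩

noncomputable def Qf (m cp cm t : ℝ) : ℝ := cp * (max t 0) ^ m + cm * (max (-t) 0) ^ m

structure Hyp (h : ℝ → ℝ) (m cp cm K η : ℝ) : Prop where
  cont : Continuous h
  pos : ∀ x, 0 < h x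
  le : ∀ x, h x ≤ h 0
  hm : 1 ≤ m
  hcp : 0 < cp
  hcm : 0 < cm
  hK : 0 < K
  hη : 0 < η
  exp : ∀ x, |x| ≤ η → |h x - (h 0 - Qf m cp cm x)| ≤ K * |x| ^ (m + 1)
  far : ∀ ρ > 0, ∃ γ > 0, ∀ x, ρ ≤ |x| → γ ≤ h 0 - h x

section Q
variable {h : ℝ → ℝ} {m cp cm K η : ℝ}

lemma Qf_cont (hm : 1 ≤ m) : Continuous (Qf m cp cm) := by
  unfold Qf
  have h1 : Continuous fun t : ℝ => (max t 0) ^ m :=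
    Continuous.rpow_const (by fun_prop) fun t => Or.inr (by linarith)
  have h2 : Continuous fun t : ℝ => (max (-t) 0) ^ m :=
    Continuous.rpow_const (by fun_prop) fun t => Or.inr (by linarith)
  fun_prop

lemma Qf_pos_eq (hm : 1 ≤ m) {t : ℝ} (ht : 0 ≤ t) : Qf m cp cm t = cp * t ^ m := by
  unfold Qf
  rw [max_eq_left ht, max_eq_right (by linarith), Real.zero_rpow (by linarith)]; ring

lemma Qf_neg_eq (hm : 1 ≤ m) {t : ℝ} (ht : t ≤ 0) : Qf m cp cm t = cm * |t| ^ m := by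
  unfold Qf
  rw [max_eq_right ht, max_eq_left (by linarith), Real.zero_rpow (by linarith), abs_of_nonpos ht]; ring

lemma Qf_scale {β t : ℝ} (hβ : 0 < β) : Qf m cp cm (β * t) = β ^ m * Qf m cp cm t := by
  unfold Qf
  have h1 : max (β * t) 0 = β * max t 0 := by
    rw [mul_max_of_nonneg _ _ hβ.le, mul_zero]
  have h2 : max (-(β * t)) 0 = β * max (-t) 0 := by
    rw [mul_max_of_nonneg _ _ hβ.le, mul_zero, mul_neg]
  rw [h1, h2, Real.mul_rpow hβ.le (le_max_right _ _), Real.mul_rpow hβ.le (le_max_right _ _)]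
  ring

lemma Qf_ge (hm : 1 ≤ m) (t : ℝ) : min cp cm * |t| ^ m ≤ Qf m cp cm t := by
  have : 0 ≤ |t| ^ m := Real.rpow_nonneg (abs_nonneg t) m
  rcases le_total 0 t with ht | ht
  · rw [Qf_pos_eq hm ht]
    rw [abs_of_nonneg ht] at this ⊢
    exact mul_le_mul_of_nonneg_right (min_le_left _ _) this
  · rw [Qf_neg_eq hm ht]
    exact mul_le_mul_of_nonneg_right (min_le_right _ _) this

lemma Qf_nonneg (hcp : 0 < cp) (hcm : 0 < cm) (t : ℝ) : 0 ≤ Qf m cp cm t := by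
  unfold Qf
  have h1 := Real.rpow_nonneg (le_max_right t 0) m
  have h2 := Real.rpow_nonneg (le_max_right (-t) 0) m
  positivity

lemma near_far (H : Hyp h m cp cm K η) : ∃ c1 > 0, ∃ ρ > 0, ∀ r, 0 ≤ r → r ≤ ρ → ∀ x, r ≤ |x| →
    c1 * r ^ m ≤ h 0 - h x := by
  obtain ⟨hcont, hpos, hle, hm, hcp, hcm, hK, hη, hexp, hfar⟩ := H
  set c0 := min cp cm with hc0
  have hc0p : 0 < c0 := lt_min hcp hcm
  set ρ := min (min η (c0 / (2 * K))) 1 with hρ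
  have hρp : 0 < ρ := by positivity
  have hρ1 : ρ ≤ η := (min_le_left _ _).trans (min_le_left _ _)
  have hρ2 : ρ ≤ c0 / (2 * K) := (min_le_left _ _).trans (min_le_right _ _)
  have hρ3 : ρ ≤ 1 := min_le_right _ _
  obtain ⟨γ, hγ, hg⟩ := hfar ρ hρp
  refine ⟨min (c0 / 2) γ, by positivity, ρ, hρp, fun r hr0 hr x hx => ?_⟩
  have hrm : 0 ≤ r ^ m := Real.rpow_nonneg hr0 m
  by_cases hxρ : |x| ≤ ρ
  · have h1 := abs_le.mp (hexp x (hxρ.trans hρ1))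
    have h2 := Qf_ge (cp := cp) (cm := cm) hm x
    have h3 : |x| ^ (m + 1) = |x| ^ m * |x| := by
      rw [Real.rpow_add_one' (abs_nonneg x) (by linarith)]
    have h4 : 0 ≤ |x| ^ m := Real.rpow_nonneg (abs_nonneg x) m
    have h5 : K * |x| ≤ c0 / 2 := by
      have := mul_le_mul_of_nonneg_left (hxρ.trans hρ2) hK.le
      calc _ ≤ _ := this
        _ = _ := by field_simp
    have h6 : r ^ m ≤ |x| ^ m := Real.rpow_le_rpow hr0 hx (by linarith)
    have h7 : min (c0 / 2) γ * r ^ m ≤ c0 / 2 * |x| ^ m :=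
      mul_le_mul (min_le_left _ _) h6 hrm (by positivity)
    rw [h3] at h1
    nlinarith [mul_le_mul_of_nonneg_right h5 h4]
  · have h1 := hg x (not_le.mp hxρ).le
    have h2 : r ^ m ≤ 1 := Real.rpow_le_one hr0 (hr.trans hρ3) (by linarith)
    calc min (c0 / 2) γ * r ^ m ≤ γ * 1 := mul_le_mul (min_le_right _ _) h2 hrm hγ.le
      _ ≤ _ := by linarith

lemma inv_sq_ineq {a M : ℝ} (ha : 0 < a) (haM : a ≤ M) : 2 * (M - a) / M ^ 3 ≤ 1 / a ^ 2 - 1 / M ^ 2 := by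
  have hM : 0 < M := ha.trans_le haM
  have : 1 / a ^ 2 - 1 / M ^ 2 - 2 * (M - a) / M ^ 3 = (M - a) ^ 2 * (M + 2 * a) / (a ^ 2 * M ^ 3) := by
    field_simp; ring
  have h2 : 0 ≤ (M - a) ^ 2 * (M + 2 * a) / (a ^ 2 * M ^ 3) := by positivity
  linarith

lemma W_lower (H : Hyp h m cp cm K η) {ε β : ℝ} (hε : 0 < ε) (hβ : 0 < β) (hβε : β ^ m * β ^ 2 = ε ^ 2) (x : ℝ) :
    2 * π ^ 2 / h 0 ^ 3 * ((h 0 - h x) / β ^ m) ≤ β ^ 2 * ((π / (ε * h x)) ^ 2 - (π / (ε * h 0)) ^ 2) := by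
  have h1 := inv_sq_ineq (H.pos x) (H.le x)
  have hbm : 0 < β ^ m := Real.rpow_pos_of_pos hβ m
  have p0 := H.pos 0
  have px := H.pos x
  have e1 : β ^ 2 * ((π / (ε * h x)) ^ 2 - (π / (ε * h 0)) ^ 2) = π ^ 2 / β ^ m * (1 / h x ^ 2 - 1 / h 0 ^ 2) := by
    rw [div_pow, div_pow, mul_pow, mul_pow, ← hβε]; field_simp
  rw [e1]
  calc _ = π ^ 2 / β ^ m * (2 * (h 0 - h x) / h 0 ^ 3) := by field_simp
    _ ≤ _ := by gcongr

end Q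

section G
variable {h : ℝ → ℝ} {m cp cm K η : ℝ}

lemma slice_int {ψ : ℝ × ℝ → ℝ} (hψ : Continuous ψ) (hs : HasCompactSupport ψ) {w : ℝ → ℝ} (hw : Continuous w) (x : ℝ) :
    Integrable fun y => ψ (x, y) * w y := by
  refine Continuous.integrable_of_hasCompactSupport (by fun_prop) ?_
  refine HasCompactSupport.intro (hs.isCompact.image continuous_snd) fun y hy => ?_
  rw [image_eq_zero_of_notMem_tsupport (f := ψ), zero_mul]
  exact fun hh => hy ⟨_, hh, rfl⟩

lemma lower_core (hcont : Continuous h) (hpos : ∀ x, 0 < h x) (hle : ∀ x, h x ≤ h 0)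
    (q : ℝ → ℝ) (hq : Continuous q) (hq0 : ∀ x, 0 ≤ q x) {j : ℕ} (hj : 1 ≤ j)
    (θ Λ0 R d ε β r : ℝ) (hθ : 0 < θ) (hθ2 : θ ≤ 1 / 2) (hε : 0 < ε) (hβ : 0 < β)
    (hΛ0 : 2 * θ * Λ0 < 1)
    (hB : 1 / θ ≤ 3 * θ * β ^ 2 * (π / (ε * h 0)) ^ 2)
    (ζ : ℝ → ℝ) (hη : ContDiff ℝ (⊤ : ℕ∞) ζ) (η0 : ∀ t, 0 ≤ ζ t) (η1 : ∀ t, ζ t ≤ 1)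
    (ηR : ∀ t, |t| ≤ R → ζ t = 1) (η2R : ∀ t, 2 * R ≤ |t| → ζ t = 0)
    (ηd : ∀ t, |deriv ζ t| ≤ d) (hd : (1 + 1 / θ) * d ^ 2 ≤ θ)
    (hqW : ∀ t, |t| ≤ 2 * R → q t ≤ β ^ 2 * ((π / (ε * h (β * t))) ^ 2 - (π / (ε * h 0)) ^ 2) + θ)
    (hWR : ∀ t, R ≤ |t| → 1 / θ ≤ β ^ 2 * ((π / (ε * h (β * t))) ^ 2 - (π / (ε * h 0)) ^ 2))
    (hΛ : β ^ 2 * (r - (π / (ε * h 0)) ^ 2) ≤ Λ0)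
    (F : Submodule ℝ ((ℝ × ℝ) → ℝ)) (hF : Module.finrank ℝ F = j)
    (hF2 : ∀ ψ ∈ F, ContDiff ℝ (⊤ : ℕ∞) ψ ∧ HasCompactSupport ψ ∧
      tsupport ψ ⊆ {p : ℝ × ℝ | 0 < p.2 ∧ p.2 < ε * h p.1})
    (hr : r = sSup { s : ℝ | ∃ ψ ∈ F, ψ ≠ (0 : (ℝ × ℝ) → ℝ) ∧
      s = (∫ p in {p : ℝ × ℝ | 0 < p.2 ∧ p.2 < ε * h p.1}, gradSq ψ p) /
        (∫ p in {p : ℝ × ℝ | 0 < p.2 ∧ p.2 < ε * h p.1}, (ψ p) ^ 2) }) :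
    schroedingerMinMax q j ≤
      (β ^ 2 * (r - (π / (ε * h 0)) ^ 2) + (4 * Λ0 + 2) * θ) / (1 - 2 * θ * Λ0) := by
  set Ω := {p : ℝ × ℝ | 0 < p.2 ∧ p.2 < ε * h p.1} with hΩ
  set V0 := (π / (ε * h 0)) ^ 2 with hV0
  set Λ := β ^ 2 * (r - V0) with hΛd
  set w := modeF (ε * h 0) with hw
  have hwc : Continuous w := modeF_cont _
  have key : ∀ ψ ∈ F, ψ ≠ 0 →
      (∫ t, (deriv (fun t => ζ t * PI ψ w (β * t)) t ^ 2 + q t * (ζ t * PI ψ w (β * t)) ^ 2)) ≤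
        (Λ + (4 * Λ0 + 2) * θ) / (1 - 2 * θ * Λ0) * ∫ t, (ζ t * PI ψ w (β * t)) ^ 2 ∧
      0 < ∫ t, (ζ t * PI ψ w (β * t)) ^ 2 := by
    intro ψ hψF hψ0
    obtain ⟨hψ, hs, hsub⟩ := hF2 ψ hψF
    have hD := mass_pos (hF2 ψ hψF) hψ0
    have hE := ray_le_2D Ω hj F hF hF2 r hr ψ hψF hψ0
    obtain ⟨l1, l2⟩ := lower2D hcont hpos hle hε hψ hs hsub β θ hβ hθ hθ2
    have hXsm : ContDiff ℝ (⊤ : ℕ∞) fun t => PI ψ w (β * t) := (PI_smooth hψ hs hwc).comp (by fun_prop)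
    have hXcs : HasCompactSupport fun t => PI ψ w (β * t) := scale_cs (PI_cs hs w) hβ
    have hnc : Continuous (PI (fun p => ψ p ^ 2) (fun _ => 1)) := (PI_smooth (sq_smooth hψ) (sq_cs hs) continuous_const).continuous
    have hncs : HasCompactSupport (PI (fun p => ψ p ^ 2) (fun _ => 1)) := PI_cs (sq_cs hs) _
    have hWc : Continuous fun t => β ^ 2 * ((π / (ε * h (β * t))) ^ 2 - V0) := by
      have : ∀ t, ε * h (β * t) ≠ 0 := fun t => (mul_pos hε (hpos _)).ne'
      have h2 : Continuous fun t => π / (ε * h (β * t)) := Continuous.div (by fun_prop) (by fun_prop) this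
      fun_prop
    have hW0 : ∀ t, 0 ≤ β ^ 2 * ((π / (ε * h (β * t))) ^ 2 - V0) := by
      intro t
      have p1 := hpos (β * t)
      have : (π / (ε * h 0)) ^ 2 ≤ (π / (ε * h (β * t))) ^ 2 := by
        have := hle (β * t)
        have := pi_pos
        have := hpos 0
        gcongr
      have : 0 ≤ (π / (ε * h (β * t))) ^ 2 - V0 := by linarith
      positivity
    obtain ⟨m1, m2⟩ := lower1D θ Λ Λ0 (3 * θ * β ^ 2 * V0) R d hθ hθ2 hΛ
      (fun t => PI ψ w (β * t)) (fun t => PI (fun p => ψ p ^ 2) (fun _ => 1) (β * t))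
      (fun t => β ^ 2 * ((π / (ε * h (β * t))) ^ 2 - V0)) q ζ hXsm hXcs (hnc.comp (by fun_prop))
      (scale_cs hncs hβ) hWc hq (fun t => (slice_ineq hpos hle hε hψ hs hsub (β * t)).2.2.1) hW0 hB
      hη η0 η1 ηR η2R ηd hd hqW hWR (l1.trans (by
        refine le_trans ?_ (le_of_eq (congrArg (Λ * ·) l2.symm))
        have : Λ * (β⁻¹ * ∫ p in Ω, ψ p ^ 2) = β * (r * (∫ p in Ω, ψ p ^ 2) - V0 * ∫ p in Ω, ψ p ^ 2) := by
          rw [hΛd]; field_simp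
        rw [this]
        gcongr))
    have hN : 0 < ∫ t, PI (fun p => ψ p ^ 2) (fun _ => 1) (β * t) := by
      have e : (∫ t, PI (fun p => ψ p ^ 2) (fun _ => 1) (β * t)) = β⁻¹ * ∫ p in Ω, ψ p ^ 2 := l2
      rw [e]; positivity
    have hp : 0 < 1 - 2 * θ * Λ0 := by linarith
    have hL : 0 ≤ ∫ t, (deriv (fun t => ζ t * PI ψ w (β * t)) t ^ 2 + q t * (ζ t * PI ψ w (β * t)) ^ 2) :=
      integral_nonneg fun x => add_nonneg (sq_nonneg _) (mul_nonneg (hq0 x) (sq_nonneg _))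
    have hc : 0 ≤ Λ + (4 * Λ0 + 2) * θ := by
      by_contra hneg
      push Not at hneg
      have := mul_neg_of_neg_of_pos hneg hN
      linarith
    refine ⟨?_, lt_of_lt_of_le (mul_pos hp hN) m2⟩
    rw [div_mul_eq_mul_div, le_div_iff₀ hp]
    calc _ ≤ ((Λ + (4 * Λ0 + 2) * θ) * ∫ t, PI (fun p => ψ p ^ 2) (fun _ => 1) (β * t)) * (1 - 2 * θ * Λ0) :=
          mul_le_mul_of_nonneg_right m1 hp.le
      _ = (Λ + (4 * Λ0 + 2) * θ) * ((1 - 2 * θ * Λ0) * ∫ t, PI (fun p => ψ p ^ 2) (fun _ => 1) (β * t)) := by ring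
      _ ≤ _ := mul_le_mul_of_nonneg_left m2 hc
  let T : F →ₗ[ℝ] (ℝ → ℝ) :=
    { toFun := fun ψ t => ζ t * PI ψ.1 w (β * t)
      map_add' := by
        intro a b
        funext t
        have ha := slice_int (hF2 a.1 a.2).1.continuous (hF2 a.1 a.2).2.1 hwc (β * t)
        have hb := slice_int (hF2 b.1 b.2).1.continuous (hF2 b.1 b.2).2.1 hwc (β * t)
        have : PI (a + b).1 w (β * t) = PI a.1 w (β * t) + PI b.1 w (β * t) := by
          unfold PI
          rw [← integral_add ha hb]
          congr 1; funext y
          simp [add_mul]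
        simp only [Pi.add_apply]
        rw [this, mul_add]
      map_smul' := by
        intro c a
        funext t
        have : PI (c • a).1 w (β * t) = c * PI a.1 w (β * t) := by
          unfold PI
          rw [← integral_const_mul]
          congr 1; funext y
          simp [mul_assoc]
        simp only [Pi.smul_apply, smul_eq_mul, RingHom.id_apply]
        rw [this]; ring }
  have hTinj : Function.Injective T := by
    rw [← LinearMap.ker_eq_bot, LinearMap.ker_eq_bot']
    intro a ha
    by_contra hne
    have h1 := (key a.1 a.2 (fun hh => hne (Subtype.ext hh))).2
    have h2 : ∀ t, ζ t * PI a.1 w (β * t) = 0 := fun t => congrFun ha t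
    simp [h2] at h1
  refine schr_le q hq0 hj (LinearMap.range T) ?_ ?_ _ ?_
  · rw [LinearMap.finrank_range_of_inj hTinj, hF]
  · rintro _ ⟨a, rfl⟩
    obtain ⟨hψ, hs, -⟩ := hF2 a.1 a.2
    have hXsm : ContDiff ℝ (⊤ : ℕ∞) fun t => PI a.1 w (β * t) := (PI_smooth hψ hs hwc).comp (by fun_prop)
    have hXcs : HasCompactSupport fun t => PI a.1 w (β * t) := scale_cs (PI_cs hs w) hβ
    exact ⟨hη.mul hXsm, hXcs.mul_left⟩
  · rintro _ ⟨a, rfl⟩ hne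
    refine (key a.1 a.2 ?_).1
    intro h0
    apply hne
    have : a = 0 := Subtype.ext h0
    rw [this, map_zero]

end G

section H
variable {h : ℝ → ℝ} {m cp cm K η : ℝ}

lemma lower_main (H : Hyp h m cp cm K η) {j : ℕ} (hj : 1 ≤ j) (δ : ℝ) (hδ : 0 < δ) :
    ∃ β0 > 0, ∀ ε β : ℝ, 0 < ε → 0 < β → β < β0 → β ^ m * β ^ 2 = ε ^ 2 → ∀ r : ℝ,
    ∀ F : Submodule ℝ ((ℝ × ℝ) → ℝ), Module.finrank ℝ F = j →
    (∀ ψ ∈ F, ContDiff ℝ (⊤ : ℕ∞) ψ ∧ HasCompactSupport ψ ∧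
      tsupport ψ ⊆ {p : ℝ × ℝ | 0 < p.2 ∧ p.2 < ε * h p.1}) →
    (r = sSup { s : ℝ | ∃ ψ ∈ F, ψ ≠ (0 : (ℝ × ℝ) → ℝ) ∧
      s = (∫ p in {p : ℝ × ℝ | 0 < p.2 ∧ p.2 < ε * h p.1}, gradSq ψ p) /
        (∫ p in {p : ℝ × ℝ | 0 < p.2 ∧ p.2 < ε * h p.1}, (ψ p) ^ 2) }) →
    schroedingerMinMax (fun t => 2 * π ^ 2 / h 0 ^ 3 * Qf m cp cm t) j - δ ≤
      β ^ 2 * (r - (π / (ε * h 0)) ^ 2) := by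
  set q := fun t => 2 * π ^ 2 / h 0 ^ 3 * Qf m cp cm t with hqd
  have hm := H.hm
  have hM := H.pos 0
  set M := h 0 with hMd
  have hpi := pi_pos
  set a := 2 * π ^ 2 / M ^ 3 with ha
  have hap : 0 < a := by positivity
  have hq0 : ∀ x, 0 ≤ q x := fun x => mul_nonneg hap.le (Qf_nonneg H.hcp H.hcm x)
  have hqc : Continuous q := continuous_const.mul (Qf_cont hm)
  set μ := schroedingerMinMax q j with hμ
  have hμ0 : 0 ≤ μ := schr_nonneg q hq0 j
  set Λ0 := μ + 1 with hΛ0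
  have hΛ0p : 0 < Λ0 := by linarith
  set D := 2 * μ * Λ0 + 4 * Λ0 + 2 with hD
  have hDp : 0 < D := by positivity
  set θ := min (1 / 2) (min (1 / (4 * Λ0)) (δ / D)) with hθd
  have hθ : 0 < θ := by positivity
  have hθ2 : θ ≤ 1 / 2 := min_le_left _ _
  have hθ3 : θ ≤ 1 / (4 * Λ0) := (min_le_right _ _).trans (min_le_left _ _)
  have hθ4 : θ ≤ δ / D := (min_le_right _ _).trans (min_le_right _ _)
  have hθ3' : 2 * θ * Λ0 < 1 := by
    rw [le_div_iff₀ (by positivity)] at hθ3; linarith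
  have hθ4' : θ * D ≤ δ := by rwa [le_div_iff₀ hDp] at hθ4
  obtain ⟨C, hC, hcut⟩ := exists_cutoff
  obtain ⟨c1, hc1, ρ, hρ, hnf⟩ := near_far H
  set A := (1 + 1 / θ) * C ^ 2 / θ with hA
  set R := max 1 (max A (1 / (θ * a * c1))) with hR
  have hR1 : 1 ≤ R := le_max_left _ _
  have hRA : A ≤ R := (le_max_left _ _).trans (le_max_right _ _)
  have hRc : 1 / (θ * a * c1) ≤ R := (le_max_right _ _).trans (le_max_right _ _)
  have hRp : 0 < R := by linarith
  have hRm : R ≤ R ^ m := by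
    simpa using Real.rpow_le_rpow_of_exponent_le hR1 hm
  obtain ⟨ζ, hζ, ζ0, ζ1, ζR, ζ2R, ζd⟩ := hcut R hRp
  have hd : (1 + 1 / θ) * (C / R) ^ 2 ≤ θ := by
    have h1 : A ≤ R ^ 2 := by nlinarith
    rw [hA, div_le_iff₀ hθ] at h1
    rw [div_pow, mul_div_assoc', div_le_iff₀ (by positivity)]
    linarith
  have hP : 0 < (2 * R) ^ (m + 1) := Real.rpow_pos_of_pos (by positivity) _
  have hKp := H.hK
  have hηp := H.hη
  refine ⟨min 1 (min (ρ / R) (min (η / (2 * R)) (min (θ / (a * K * (2 * R) ^ (m + 1)))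
    (3 * θ ^ 2 * π ^ 2 / M ^ 2)))), by positivity, ?_⟩
  intro ε β hε hβ hβ0 hβε r F hF hF2 hr
  simp only [lt_min_iff] at hβ0
  obtain ⟨b1, b2, b3, b4, b5⟩ := hβ0
  rw [lt_div_iff₀ (by positivity)] at b2 b3 b4
  have hbm : 0 < β ^ m := Real.rpow_pos_of_pos hβ m
  have hbmle : β ^ m ≤ β := by
    simpa using Real.rpow_le_rpow_of_exponent_ge hβ b1.le hm
  rcases le_total Λ0 (β ^ 2 * (r - (π / (ε * M)) ^ 2)) with hcase | hcase
  · linarith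
  have hB : 1 / θ ≤ 3 * θ * β ^ 2 * (π / (ε * M)) ^ 2 := by
    have e : 3 * θ * β ^ 2 * (π / (ε * M)) ^ 2 = 3 * θ * π ^ 2 / (M ^ 2 * β ^ m) := by
      rw [div_pow, mul_pow, ← hβε]; field_simp
    rw [e, div_le_div_iff₀ hθ (by positivity)]
    have : β ^ m ≤ 3 * θ ^ 2 * π ^ 2 / M ^ 2 := hbmle.trans b5.le
    rw [le_div_iff₀ (by positivity)] at this
    nlinarith
  have hWl := fun t => W_lower H hε hβ hβε (β * t)
  have hWR : ∀ t, R ≤ |t| → 1 / θ ≤ β ^ 2 * ((π / (ε * h (β * t))) ^ 2 - (π / (ε * M)) ^ 2) := by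
    intro t ht
    refine le_trans ?_ (hWl t)
    have h1 := hnf (β * R) (by positivity) b2.le (β * t) (by
      rw [abs_mul, abs_of_pos hβ]; gcongr)
    rw [Real.mul_rpow hβ.le hRp.le] at h1
    have h2 : c1 * R ^ m ≤ (M - h (β * t)) / β ^ m := by
      rw [le_div_iff₀ hbm]; linarith
    have h3 : 1 / θ ≤ a * (c1 * R ^ m) := by
      rw [div_le_iff₀ (by positivity)] at hRc
      rw [div_le_iff₀ hθ]
      have : R * (θ * a * c1) ≤ R ^ m * (θ * a * c1) := by gcongr
      linarith
    exact h3.trans (mul_le_mul_of_nonneg_left h2 hap.le)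
  have hqW : ∀ t, |t| ≤ 2 * R → q t ≤ β ^ 2 * ((π / (ε * h (β * t))) ^ 2 - (π / (ε * M)) ^ 2) + θ := by
    intro t ht
    have hx : |β * t| ≤ η := by
      rw [abs_mul, abs_of_pos hβ]
      have := mul_le_mul_of_nonneg_left ht hβ.le
      linarith
    have h1 := (abs_le.mp (H.exp (β * t) hx)).2
    rw [Qf_scale hβ, abs_mul, abs_of_pos hβ, Real.mul_rpow hβ.le (abs_nonneg t),
      Real.rpow_add_one hβ.ne'] at h1
    have h2 : |t| ^ (m + 1) ≤ (2 * R) ^ (m + 1) := Real.rpow_le_rpow (abs_nonneg t) ht (by linarith)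
    have h3 : Qf m cp cm t - K * β * (2 * R) ^ (m + 1) ≤ (M - h (β * t)) / β ^ m := by
      rw [le_div_iff₀ hbm]
      have : K * (β ^ m * β * |t| ^ (m + 1)) ≤ K * (β ^ m * β * (2 * R) ^ (m + 1)) := by gcongr
      linarith
    have h4 := mul_le_mul_of_nonneg_left h3 hap.le
    have h5 := hWl t
    have h6 : q t = a * Qf m cp cm t := rfl
    have h7 : a * ((M - h (β * t)) / β ^ m) ≤ β ^ 2 * ((π / (ε * h (β * t))) ^ 2 - (π / (ε * M)) ^ 2) := h5
    rw [h6]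
    linarith
  have hfin := lower_core H.cont H.pos H.le q hqc hq0 hj θ Λ0 R (C / R) ε β r hθ hθ2 hε hβ hθ3' hB ζ hζ ζ0 ζ1 ζR ζ2R ζd hd
    hqW hWR hcase F hF hF2 hr
  rw [le_div_iff₀ (by linarith)] at hfin
  have : μ * (1 - 2 * θ * Λ0) ≤ β ^ 2 * (r - (π / (ε * M)) ^ 2) + (4 * Λ0 + 2) * θ := hfin
  have e : θ * D = 2 * μ * Λ0 * θ + (4 * Λ0 + 2) * θ := by rw [hD]; ring
  linarith

end H

lemma exists_zeta : ∃ C > 0, ∀ n : ℝ, 8 ≤ n → ∃ ζ : ℝ → ℝ, ContDiff ℝ (⊤ : ℕ∞) ζ ∧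
    (∀ s, s ≤ 1 / n → ζ s = 0) ∧ (∀ s, 1 - 1 / n ≤ s → ζ s = 0) ∧
    (∀ s, 2 / n ≤ s → s ≤ 1 - 2 / n → ζ s = 1) ∧ (∀ s, |deriv ζ s| ≤ C * n) := by
  obtain ⟨C, hC, hb⟩ := st_deriv_bdd
  refine ⟨2 * C, by positivity, fun n hn => ?_⟩
  have hn0 : 0 < n := by linarith
  set S := Real.smoothTransition with hS
  have hS0 : ∀ x, 0 ≤ S x := Real.smoothTransition.nonneg
  have hS1 : ∀ x, S x ≤ 1 := Real.smoothTransition.le_one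
  refine ⟨fun s => S (n * s - 1) * S (n - 1 - n * s), ?_, ?_, ?_, ?_, ?_⟩
  · have hs : ContDiff ℝ ((⊤ : ℕ∞) : WithTop ℕ∞) S := Real.smoothTransition.contDiff
    exact (hs.comp (by fun_prop)).mul (hs.comp (by fun_prop))
  · intro s hs
    rw [le_div_iff₀ hn0] at hs
    simp only
    rw [hS, Real.smoothTransition.zero_of_nonpos (by linarith : n * s - 1 ≤ 0), zero_mul]
  · intro s hs
    have : n * (1 - 1 / n) ≤ n * s := by gcongr
    rw [mul_sub, mul_one_div_cancel hn0.ne'] at this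
    simp only
    rw [hS, Real.smoothTransition.zero_of_nonpos (by linarith : n - 1 - n * s ≤ 0), mul_zero]
  · intro s h1 h2
    have a1 : n * (2 / n) ≤ n * s := by gcongr
    have a2 : n * s ≤ n * (1 - 2 / n) := by gcongr
    rw [mul_div_cancel₀ _ hn0.ne'] at a1
    rw [mul_sub, mul_div_cancel₀ _ hn0.ne'] at a2
    simp only
    rw [hS, Real.smoothTransition.one_of_one_le (by linarith : 1 ≤ n * s - 1),
      Real.smoothTransition.one_of_one_le (by linarith : 1 ≤ n - 1 - n * s), mul_one]
  · intro s
    have d1 : HasDerivAt (fun s => n * s - 1) n s := by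
      simpa using ((hasDerivAt_id s).const_mul n).sub_const 1
    have d2 : HasDerivAt (fun s => n - 1 - n * s) (-n) s := by
      simpa using ((hasDerivAt_id s).const_mul n).const_sub (n - 1)
    have d3 := ((st_hasDeriv (n * s - 1)).comp s d1).mul ((st_hasDeriv (n - 1 - n * s)).comp s d2)
    have d4 : deriv (fun s => S (n * s - 1) * S (n - 1 - n * s)) s = _ := d3.deriv
    rw [d4]
    simp only [Function.comp_apply]
    have b1 := hb (n * s - 1)
    have b2 := hb (n - 1 - n * s)
    refine (abs_add_le _ _).trans ?_
    rw [abs_mul, abs_mul, abs_mul, abs_mul, abs_neg, abs_of_pos hn0, abs_of_nonneg (Real.smoothTransition.nonneg (n * s - 1)),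
      abs_of_nonneg (Real.smoothTransition.nonneg (n - 1 - n * s))]
    have e1 := mul_le_mul (mul_le_mul_of_nonneg_right b1 hn0.le) (hS1 (n - 1 - n * s)) (hS0 _) (by positivity)
    have e2 := mul_le_mul (hS1 (n * s - 1)) (mul_le_mul_of_nonneg_right b2 hn0.le) (by positivity) (by positivity)
    linarith

lemma exists_u (κ : ℝ) (hκ : 0 < κ) : ∃ u : ℝ → ℝ, ContDiff ℝ (⊤ : ℕ∞) u ∧ HasCompactSupport u ∧
    tsupport u ⊆ Ioo 0 1 ∧ 0 < ∫ s, u s ^ 2 ∧ (∫ s, deriv u s ^ 2) ≤ (π ^ 2 + κ) * ∫ s, u s ^ 2 := by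
  obtain ⟨C, hC, hz⟩ := exists_zeta
  have hpi := pi_pos
  set c := 4 * π ^ 2 * C ^ 2 with hc
  have hcp : 0 < c := by positivity
  set n := max 8 (16 * c / κ) with hnd
  have hn : 8 ≤ n := le_max_left _ _
  have hn2 : 16 * c / κ ≤ n := le_max_right _ _
  have hn0 : 0 < n := by linarith
  obtain ⟨ζ, hζ, z1, z2, z3, z4⟩ := hz n hn
  have hinv : 0 < 1 / n := by positivity
  have hinv2 : 2 / n ≤ 1 / 4 := by
    rw [div_le_iff₀ hn0]; linarith
  have h2n : 2 / n = 2 * (1 / n) := by ring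
  set u : ℝ → ℝ := fun s => sin (π * s) * ζ s with hu
  have hus : ContDiff ℝ (⊤ : ℕ∞) u :=
    (Real.contDiff_sin.comp (contDiff_const.mul contDiff_id)).mul hζ
  have hts0 : ∀ f : ℝ → ℝ, (∀ s, ζ s = 0 → f s = 0) → tsupport f ⊆ Icc (1 / n) (1 - 1 / n) := by
    intro f hf
    refine closure_minimal (fun s hs => ?_) isClosed_Icc
    by_contra hcon
    apply hs
    apply hf
    rcases le_total s (1 / n) with h | h
    · exact z1 s h
    · exact z2 s (by by_contra h3; exact hcon ⟨h, (not_le.mp h3).le⟩)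
  have hts : tsupport u ⊆ Icc (1 / n) (1 - 1 / n) := hts0 u (by intro s hs; simp [hu, hs])
  have hucs : HasCompactSupport u := isCompact_Icc.of_isClosed_subset (isClosed_tsupport u) hts
  have hζc := hζ.continuous
  have hζ'c := (deriv_smooth1 hζ).continuous
  have hζcs : HasCompactSupport ζ :=
    isCompact_Icc.of_isClosed_subset (isClosed_tsupport ζ) (hts0 ζ fun _ h => h)
  have dsin : ∀ s, HasDerivAt (fun s => sin (π * s)) (cos (π * s) * π) s := by
    intro s
    exact (Real.hasDerivAt_sin (π * s)).comp s (by simpa using (hasDerivAt_id s).const_mul π)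
  have dcos : ∀ s, HasDerivAt (fun s => cos (π * s)) (-sin (π * s) * π) s := by
    intro s
    exact (Real.hasDerivAt_cos (π * s)).comp s (by simpa using (hasDerivAt_id s).const_mul π)
  have dz : ∀ s, HasDerivAt ζ (deriv ζ s) s := fun s => (diff1 hζ s).hasDerivAt
  have hu' : ∀ s, deriv u s = cos (π * s) * π * ζ s + sin (π * s) * deriv ζ s := fun s =>
    ((dsin s).mul (dz s)).deriv
  -- derivative zero part
  set v' : ℝ → ℝ := fun s => π * ((cos (π * s) * π * cos (π * s) + sin (π * s) * (-sin (π * s) * π)) * ζ s ^ 2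
     + (sin (π * s) * cos (π * s)) * (2 * ζ s * deriv ζ s)) with hv'
  have hv : ∫ s, v' s = 0 := by
    refine integral_eq_zero_of_hasDerivAt_of_integrable
      (f := fun s => π * ((sin (π * s) * cos (π * s)) * ζ s ^ 2)) ?_ ?_ ?_
    · intro s
      refine ((((dsin s).mul (dcos s)).mul ((dz s).pow 2)).const_mul π).congr_deriv ?_
      simp only [hv', Nat.cast_ofNat, pow_one, Pi.mul_apply, Nat.add_one_sub_one, Pi.pow_apply]
    · refine Continuous.integrable_of_hasCompactSupport (by fun_prop) ?_
      refine HasCompactSupport.intro hζcs.isCompact fun s hs => ?_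
      have : ζ s = 0 := image_eq_zero_of_notMem_tsupport hs
      simp [hv', this]
    · refine Continuous.integrable_of_hasCompactSupport (by fun_prop) ?_
      refine HasCompactSupport.intro hζcs.isCompact fun s hs => ?_
      have : ζ s = 0 := image_eq_zero_of_notMem_tsupport hs
      simp [this]
  have hid : ∀ s, deriv u s ^ 2 = π ^ 2 * u s ^ 2 + v' s + (sin (π * s) * deriv ζ s) ^ 2 := by
    intro s
    rw [hu' s]; simp only [hv', hu]; ring
  have iv : Integrable v' := by
    refine Continuous.integrable_of_hasCompactSupport (by fun_prop) ?_
    refine HasCompactSupport.intro hζcs.isCompact fun s hs => ?_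
    have : ζ s = 0 := image_eq_zero_of_notMem_tsupport hs
    simp [hv', this]
  have iu : Integrable fun s => π ^ 2 * u s ^ 2 :=
    (Continuous.integrable_of_hasCompactSupport (hus.continuous.pow 2) (sq_cs hucs)).const_mul _
  have iw : Integrable fun s => (sin (π * s) * deriv ζ s) ^ 2 := by
    refine Continuous.integrable_of_hasCompactSupport (by fun_prop) ?_
    exact sq_cs (hζcs.deriv.mul_left (f := fun s => sin (π * s)))
  have hsum : ∫ s, deriv u s ^ 2 = π ^ 2 * (∫ s, u s ^ 2) + ∫ s, (sin (π * s) * deriv ζ s) ^ 2 := by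
    simp_rw [hid]
    have a1 : ∫ s, (π ^ 2 * u s ^ 2 + v' s + (sin (π * s) * deriv ζ s) ^ 2) =
        (∫ s, (π ^ 2 * u s ^ 2 + v' s)) + ∫ s, (sin (π * s) * deriv ζ s) ^ 2 := integral_add (iu.add iv) iw
    rw [a1, integral_add iu iv, hv, integral_const_mul, add_zero]
  have hw : ∫ s, (sin (π * s) * deriv ζ s) ^ 2 ≤ c * (4 / n) := by
    have hle : ∀ s, (sin (π * s) * deriv ζ s) ^ 2 ≤
        (Icc 0 (2 / n)).indicator (fun _ => c) s + (Icc (1 - 2 / n) 1).indicator (fun _ => c) s := by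
      intro s
      have i1 : 0 ≤ (Icc 0 (2 / n)).indicator (fun _ => c) s := indicator_nonneg (fun _ _ => hcp.le) s
      have i2 : 0 ≤ (Icc (1 - 2 / n) 1).indicator (fun _ => c) s := indicator_nonneg (fun _ _ => hcp.le) s
      have main : |sin (π * s)| ≤ π * (2 / n) → (sin (π * s) * deriv ζ s) ^ 2 ≤ c := by
        intro hs
        rw [← sq_abs, abs_mul]
        have : |sin (π * s)| * |deriv ζ s| ≤ π * (2 / n) * (C * n) :=
          mul_le_mul hs (z4 s) (abs_nonneg _) (by positivity)
        have e : π * (2 / n) * (C * n) = 2 * π * C := by field_simp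
        rw [e] at this
        calc _ ≤ (2 * π * C) ^ 2 := by gcongr
          _ = c := by rw [hc]; ring
      by_cases hA : s ∈ Icc 0 (2 / n)
      · rw [indicator_of_mem hA]
        have : |sin (π * s)| ≤ π * (2 / n) := by
          refine Real.abs_sin_le_abs.trans ?_
          rw [abs_of_nonneg (mul_nonneg hpi.le hA.1)]
          exact mul_le_mul_of_nonneg_left hA.2 hpi.le
        linarith [main this]
      by_cases hB : s ∈ Icc (1 - 2 / n) 1
      · rw [indicator_of_mem hB]
        have : |sin (π * s)| ≤ π * (2 / n) := by
          have e : sin (π * s) = sin (π * (1 - s)) := by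
            rw [mul_sub, mul_one, Real.sin_pi_sub]
          rw [e]
          refine Real.abs_sin_le_abs.trans ?_
          rw [abs_of_nonneg (mul_nonneg hpi.le (by linarith [hB.2]))]
          exact mul_le_mul_of_nonneg_left (by linarith [hB.1]) hpi.le
        linarith [main this]
      have hd0 : deriv ζ s = 0 := by
        have : (∃ a, ζ =ᶠ[nhds s] fun _ => a) := by
          by_cases h1 : s < 0
          · refine ⟨0, ?_⟩
            filter_upwards [Iio_mem_nhds h1] with x hx
            exact z1 x (by linarith [mem_Iio.mp hx])
          by_cases h2 : 1 < s
          · refine ⟨0, ?_⟩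
            filter_upwards [Ioi_mem_nhds h2] with x hx
            exact z2 x (by linarith [mem_Ioi.mp hx])
          have h3 : 2 / n < s := by
            by_contra h; exact hA ⟨not_lt.mp h1, not_lt.mp h⟩
          have h4 : s < 1 - 2 / n := by
            by_contra h; exact hB ⟨not_lt.mp h, not_lt.mp h2⟩
          refine ⟨1, ?_⟩
          filter_upwards [Ioo_mem_nhds h3 h4] with x hx
          exact z3 x hx.1.le hx.2.le
        obtain ⟨a, ha⟩ := this
        rw [ha.deriv_eq]; simp
      rw [hd0]; simp only [mul_zero, ne_eq, OfNat.ofNat_ne_zero, not_false_eq_true, zero_pow]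
      positivity
    have j1 : Integrable ((Icc 0 (2 / n)).indicator (fun _ => c)) := by
      rw [integrable_indicator_iff measurableSet_Icc]
      simp
    have j2 : Integrable ((Icc (1 - 2 / n) 1).indicator (fun _ => c)) := by
      rw [integrable_indicator_iff measurableSet_Icc]
      simp
    refine (integral_mono iw (j1.add j2) hle).trans ?_
    have := integral_add j1 j2
    simp only [Pi.add_apply]
    rw [this, integral_indicator measurableSet_Icc, integral_indicator measurableSet_Icc]
    have hp : 0 ≤ 2 / n := by positivity
    simp only [integral_const, MeasurableSet.univ, measureReal_restrict_apply, univ_inter, Real.volume_real_Icc, smul_eq_mul]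
    rw [max_eq_left (by linarith), max_eq_left (by linarith)]
    apply le_of_eq; ring
  have hU : 1 / 4 ≤ ∫ s, u s ^ 2 := by
    have hle : ∀ s, (Icc (1 / 4 : ℝ) (3 / 4)).indicator (fun _ => (1 / 2 : ℝ)) s ≤ u s ^ 2 := by
      intro s
      by_cases hs : s ∈ Icc (1 / 4 : ℝ) (3 / 4)
      · rw [indicator_of_mem hs]
        have : ζ s = 1 := z3 s (by linarith [hs.1]) (by linarith [hs.2])
        simp only [hu, this, mul_one]
        have h1 : cos (2 * (π * s)) ≤ 0 :=
          Real.cos_nonpos_of_pi_div_two_le_of_le (by nlinarith [hs.1]) (by nlinarith [hs.2])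
        rw [Real.cos_two_mul] at h1
        nlinarith [Real.sin_sq_add_cos_sq (π * s)]
      · rw [indicator_of_notMem hs]; positivity
    have j1 : Integrable ((Icc (1 / 4 : ℝ) (3 / 4)).indicator (fun _ => (1 / 2 : ℝ))) := by
      rw [integrable_indicator_iff measurableSet_Icc]
      simp
    refine le_trans ?_ (integral_mono j1 (Continuous.integrable_of_hasCompactSupport (hus.continuous.pow 2) (sq_cs hucs)) hle)
    rw [integral_indicator measurableSet_Icc]
    simp only [integral_const, MeasurableSet.univ, measureReal_restrict_apply, univ_inter, Real.volume_real_Icc, smul_eq_mul]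
    norm_num
  refine ⟨u, hus, hucs, hts.trans ?_, by linarith, ?_⟩
  · intro s hs
    exact ⟨by linarith [hs.1], by linarith [hs.2]⟩
  · rw [hsum]
    have : c * (4 / n) ≤ κ * (1 / 4) := by
      rw [div_le_iff₀ hκ] at hn2
      rw [mul_div_assoc', div_le_iff₀ hn0]
      linarith
    nlinarith

lemma common_support (G : Submodule ℝ (ℝ → ℝ)) [FiniteDimensional ℝ G]
    (hG : ∀ χ ∈ G, HasCompactSupport χ) : ∃ R > 0, ∀ χ ∈ G, ∀ t, R < |t| → χ t = 0 := by
  obtain ⟨s, hs⟩ := (Submodule.fg_iff_finiteDimensional G).mpr inferInstance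
  have hcomp : IsCompact (⋃ χ ∈ (s : Set (ℝ → ℝ)), tsupport χ) :=
    s.finite_toSet.isCompact_biUnion fun χ hχ => (hG χ (hs ▸ Submodule.subset_span hχ)).isCompact
  obtain ⟨R, hR⟩ := hcomp.isBounded.exists_norm_le
  refine ⟨max R 1, by positivity, fun χ hχ t ht => ?_⟩
  rw [← hs] at hχ
  induction hχ using Submodule.span_induction with
  | mem x hx =>
    by_contra hne
    have := hR t (mem_biUnion hx (subset_tsupport x hne))
    rw [Real.norm_eq_abs] at this
    linarith [le_max_left R 1]
  | zero => rfl
  | add x y _ _ hx hy => simp [hx, hy]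
  | smul a x _ hx => simp [hx]

noncomputable def trial (χ u k : ℝ → ℝ) (β ε : ℝ) (p : ℝ × ℝ) : ℝ :=
  χ (β⁻¹ * p.1) * u (ε⁻¹ * k (β⁻¹ * p.1) * p.2)

section J
variable {h χ u k : ℝ → ℝ} {β ε R : ℝ}

lemma trial_smooth (hχ : ContDiff ℝ (⊤ : ℕ∞) χ) (hu : ContDiff ℝ (⊤ : ℕ∞) u) (hk : ContDiff ℝ (⊤ : ℕ∞) k) :
    ContDiff ℝ (⊤ : ℕ∞) (trial χ u k β ε) := by
  unfold trial
  have h1 : ContDiff ℝ (⊤ : ℕ∞) fun p : ℝ × ℝ => β⁻¹ * p.1 := contDiff_const.mul contDiff_fst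
  exact (hχ.comp h1).mul (hu.comp ((contDiff_const.mul (hk.comp h1)).mul contDiff_snd))

lemma trial_supp (hε : 0 < ε) (hβ : 0 < β) (hle : ∀ x, h x ≤ h 0)
    (hχR : ∀ t, R < |t| → χ t = 0) (hu1 : tsupport u ⊆ Ioo 0 1) (hk : Continuous k)
    (hk0 : ∀ t, 0 < k t) (hkh : ∀ t, |t| ≤ R → 1 ≤ h (β * t) * k t) :
    HasCompactSupport (trial χ u k β ε) ∧
      tsupport (trial χ u k β ε) ⊆ {p : ℝ × ℝ | 0 < p.2 ∧ p.2 < ε * h p.1} := by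
  set Z : Set (ℝ × ℝ) := {p | |β⁻¹ * p.1| ≤ R} ∩ {p | ε⁻¹ * k (β⁻¹ * p.1) * p.2 ∈ tsupport u} with hZ
  have hZc : IsClosed Z := by
    refine IsClosed.inter (isClosed_le (by fun_prop) continuous_const) ?_
    exact (isClosed_tsupport u).preimage (f := fun p : ℝ × ℝ => ε⁻¹ * k (β⁻¹ * p.1) * p.2) (by fun_prop)
  have hsub : tsupport (trial χ u k β ε) ⊆ Z := by
    refine closure_minimal (fun p hp => ?_) hZc
    have hp' : χ (β⁻¹ * p.1) * u (ε⁻¹ * k (β⁻¹ * p.1) * p.2) ≠ 0 := hp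
    refine ⟨?_, subset_tsupport u (right_ne_zero_of_mul hp')⟩
    by_contra hcon
    exact left_ne_zero_of_mul hp' (hχR _ (not_le.mp hcon))
  have hZΩ : Z ⊆ {p : ℝ × ℝ | 0 < p.2 ∧ p.2 < ε * h p.1} := by
    rintro ⟨x, y⟩ ⟨h1, h2⟩
    simp only [mem_ofPred_eq] at h1 h2 ⊢
    have h3 := hu1 h2
    have hkp := hk0 (β⁻¹ * x)
    have h4 := hkh _ h1
    rw [mul_inv_cancel_left₀ hβ.ne'] at h4
    have e : ε⁻¹ * k (β⁻¹ * x) * y = y * k (β⁻¹ * x) / ε := by field_simp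
    rw [e] at h3
    obtain ⟨h5, h6⟩ := h3
    rw [div_lt_one hε] at h6
    have h7 : 0 < y * k (β⁻¹ * x) := by
      have := mul_pos h5 hε
      rwa [div_mul_cancel₀ _ hε.ne'] at this
    refine ⟨pos_of_mul_pos_left h7 hkp.le, ?_⟩
    have : y * k (β⁻¹ * x) < (ε * h x) * k (β⁻¹ * x) := by nlinarith
    exact lt_of_mul_lt_mul_right this hkp.le
  refine ⟨?_, hsub.trans hZΩ⟩
  have hcomp : IsCompact (Icc (-(β * R)) (β * R) ×ˢ Icc 0 (ε * h 0)) := isCompact_Icc.prod isCompact_Icc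
  refine hcomp.of_isClosed_subset (isClosed_tsupport _) fun p hp => ?_
  have h1 := hsub hp
  have h2 := hZΩ h1
  have h3 : |β⁻¹ * p.1| ≤ R := h1.1
  refine ⟨?_, h2.1.le, h2.2.le.trans (mul_le_mul_of_nonneg_left (hle _) hε.le)⟩
  rw [abs_mul, abs_of_pos (inv_pos.mpr hβ), inv_mul_le_iff₀ hβ] at h3
  exact abs_le.mp h3

lemma trial_dX (hχ : ContDiff ℝ (⊤ : ℕ∞) χ) (hu : ContDiff ℝ (⊤ : ℕ∞) u) (hk : ContDiff ℝ (⊤ : ℕ∞) k) (x y : ℝ) :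
    dX (trial χ u k β ε) (x, y) = β⁻¹ * (deriv χ (β⁻¹ * x) * u (ε⁻¹ * k (β⁻¹ * x) * y) +
      χ (β⁻¹ * x) * (ε⁻¹ * deriv k (β⁻¹ * x) * y) * deriv u (ε⁻¹ * k (β⁻¹ * x) * y)) := by
  refine (hasDerivAt_sliceX (trial_smooth hχ hu hk) x y).unique ?_
  have d0 : HasDerivAt (fun s => β⁻¹ * s) β⁻¹ x := by simpa using (hasDerivAt_id x).const_mul β⁻¹
  have d1 := ((diff1 hχ (β⁻¹ * x)).hasDerivAt).comp x d0
  have d2 := ((diff1 hk (β⁻¹ * x)).hasDerivAt).comp x d0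
  have d3 := (d2.const_mul ε⁻¹).mul_const y
  have d4 := ((diff1 hu (ε⁻¹ * k (β⁻¹ * x) * y)).hasDerivAt).comp x d3
  refine (d1.mul d4).congr_deriv ?_
  simp only [Function.comp_apply]
  ring

lemma trial_dY (hχ : ContDiff ℝ (⊤ : ℕ∞) χ) (hu : ContDiff ℝ (⊤ : ℕ∞) u) (hk : ContDiff ℝ (⊤ : ℕ∞) k) (x y : ℝ) :
    dY (trial χ u k β ε) (x, y) = χ (β⁻¹ * x) * (ε⁻¹ * k (β⁻¹ * x)) * deriv u (ε⁻¹ * k (β⁻¹ * x) * y) := by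
  refine (hasDerivAt_sliceY (trial_smooth hχ hu hk) x y).unique ?_
  have d3 : HasDerivAt (fun y => ε⁻¹ * k (β⁻¹ * x) * y) (ε⁻¹ * k (β⁻¹ * x)) y := by
    simpa using (hasDerivAt_id y).const_mul (ε⁻¹ * k (β⁻¹ * x))
  have d4 := ((diff1 hu (ε⁻¹ * k (β⁻¹ * x) * y)).hasDerivAt).comp y d3
  refine (d4.const_mul (χ (β⁻¹ * x))).congr_deriv ?_
  ring

lemma trial_mass_slice (hε : 0 < ε) (hk0 : ∀ t, 0 < k t) (x : ℝ) :
    PI (fun p => trial χ u k β ε p ^ 2) (fun _ => 1) x =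
      χ (β⁻¹ * x) ^ 2 * (ε / k (β⁻¹ * x)) * ∫ s, u s ^ 2 := by
  unfold PI trial
  simp only [mul_one, mul_pow]
  rw [integral_const_mul]
  have hp : 0 < ε⁻¹ * k (β⁻¹ * x) := mul_pos (inv_pos.mpr hε) (hk0 _)
  rw [Measure.integral_comp_mul_left (fun s => u s ^ 2) (ε⁻¹ * k (β⁻¹ * x)), abs_of_pos (inv_pos.mpr hp), smul_eq_mul]
  rw [mul_inv, inv_inv]; ring

lemma trial_dY_slice (hχ : ContDiff ℝ (⊤ : ℕ∞) χ) (hu : ContDiff ℝ (⊤ : ℕ∞) u) (hk : ContDiff ℝ (⊤ : ℕ∞) k)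
    (hε : 0 < ε) (hk0 : ∀ t, 0 < k t) (x : ℝ) :
    PI (fun p => dY (trial χ u k β ε) p ^ 2) (fun _ => 1) x =
      χ (β⁻¹ * x) ^ 2 * (k (β⁻¹ * x) / ε) * ∫ s, deriv u s ^ 2 := by
  unfold PI
  simp only [trial_dY hχ hu hk, mul_one]
  have hp : 0 < ε⁻¹ * k (β⁻¹ * x) := mul_pos (inv_pos.mpr hε) (hk0 _)
  have hkp := hk0 (β⁻¹ * x)
  simp only [mul_pow _ (deriv u _)]
  rw [integral_const_mul]
  rw [Measure.integral_comp_mul_left (fun s => deriv u s ^ 2) (ε⁻¹ * k (β⁻¹ * x)), abs_of_pos (inv_pos.mpr hp), smul_eq_mul]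
  field_simp

lemma trial_dX_slice (hχ : ContDiff ℝ (⊤ : ℕ∞) χ) (hu : ContDiff ℝ (⊤ : ℕ∞) u) (hk : ContDiff ℝ (⊤ : ℕ∞) k)
    (hucs : HasCompactSupport u) (hu1 : tsupport u ⊆ Ioo 0 1)
    (hε : 0 < ε) (hk0 : ∀ t, 0 < k t) (τ : ℝ) (hτ : 0 < τ) (x : ℝ)
    (hint : Integrable fun y => dX (trial χ u k β ε) (x, y) ^ 2) :
    PI (fun p => dX (trial χ u k β ε) p ^ 2) (fun _ => 1) x ≤
      (β⁻¹) ^ 2 * (ε / k (β⁻¹ * x)) * ((1 + τ) * deriv χ (β⁻¹ * x) ^ 2 * (∫ s, u s ^ 2) +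
        (1 + 1 / τ) * (deriv k (β⁻¹ * x) / k (β⁻¹ * x)) ^ 2 * χ (β⁻¹ * x) ^ 2 * ∫ s, deriv u s ^ 2) := by
  unfold PI
  simp only [mul_one]
  have hp : 0 < ε⁻¹ * k (β⁻¹ * x) := mul_pos (inv_pos.mpr hε) (hk0 _)
  have hkp := hk0 (β⁻¹ * x)
  set t := β⁻¹ * x with ht
  set c := ε⁻¹ * k t with hc
  have iu : Integrable fun s => u s ^ 2 :=
    Continuous.integrable_of_hasCompactSupport (hu.continuous.pow 2) (sq_cs hucs)
  have iu' : Integrable fun s => deriv u s ^ 2 :=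
    Continuous.integrable_of_hasCompactSupport ((deriv_smooth1 hu).continuous.pow 2) (sq_cs hucs.deriv)
  set a1 := (β⁻¹) ^ 2 * ((1 + τ) * deriv χ t ^ 2) with ha1
  set a2 := (β⁻¹) ^ 2 * ((1 + 1 / τ) * (deriv k t / k t) ^ 2 * χ t ^ 2) with ha2
  have ha2p : 0 ≤ a2 := by positivity
  have j1 : Integrable fun y => a1 * u (c * y) ^ 2 := (iu.comp_mul_left' hp.ne').const_mul a1
  have j2 : Integrable fun y => a2 * deriv u (c * y) ^ 2 := (iu'.comp_mul_left' hp.ne').const_mul a2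
  have hle : ∀ y, dX (trial χ u k β ε) (x, y) ^ 2 ≤ a1 * u (c * y) ^ 2 + a2 * deriv u (c * y) ^ 2 := by
    intro y
    rw [trial_dX hχ hu hk x y]
    set s := c * y with hs
    have es : ε⁻¹ * deriv k t * y = deriv k t / k t * s := by
      rw [hs, hc]; field_simp
    have e0 : ε⁻¹ * k t * y = s := rfl
    rw [← ht, es]
    set b := deriv χ t * u s with hb
    set d := χ t * (deriv k t / k t) * deriv u s with hd
    have hs1 : (s * d) ^ 2 ≤ d ^ 2 := by
      by_cases hmem : s ∈ tsupport u
      · have := hu1 hmem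
        rw [mul_pow]
        have : s ^ 2 ≤ 1 := by nlinarith [this.1, this.2]
        nlinarith [sq_nonneg d]
      · have : deriv u s = 0 := by
          refine image_eq_zero_of_notMem_tsupport fun hh => hmem ?_
          exact tsupport_deriv_subset hh
        simp [hd, this]
    have hyoung : (b + s * d) ^ 2 ≤ (1 + τ) * b ^ 2 + (1 + 1 / τ) * (s * d) ^ 2 := by
      have : (1 + τ) * b ^ 2 + (1 + 1 / τ) * (s * d) ^ 2 - (b + s * d) ^ 2 = (τ * b - s * d) ^ 2 / τ := by
        field_simp; ring
      have h2 : 0 ≤ (τ * b - s * d) ^ 2 / τ := by positivity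
      linarith
    have h3 : (1 + 1 / τ) * (s * d) ^ 2 ≤ (1 + 1 / τ) * d ^ 2 := by gcongr
    calc _ = (β⁻¹) ^ 2 * (b + s * d) ^ 2 := by rw [hb, hd]; ring
      _ ≤ (β⁻¹) ^ 2 * ((1 + τ) * b ^ 2 + (1 + 1 / τ) * d ^ 2) := by
        apply mul_le_mul_of_nonneg_left _ (sq_nonneg _); linarith
      _ = _ := by rw [hb, hd, ha1, ha2]; ring
  refine (integral_mono hint (j1.add j2) hle).trans ?_
  have e := integral_add j1 j2
  simp only [Pi.add_apply]
  rw [e, integral_const_mul, integral_const_mul,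
    Measure.integral_comp_mul_left (fun s => deriv u s ^ 2) c, Measure.integral_comp_mul_left (fun s => u s ^ 2) c,
    abs_of_pos (inv_pos.mpr hp), smul_eq_mul, smul_eq_mul]
  have : c⁻¹ = ε / k t := by rw [hc, mul_inv, inv_inv]; rfl
  rw [this, ha1, ha2]
  apply le_of_eq; ring

end J

noncomputable def rhoE (τ δ G0 G1 e0 M : ℝ) : ℝ :=
  (τ + τ ^ 2) * G1 ^ 2 * (π ^ 2 + δ * τ) + e0 + (π ^ 2 * τ * G0 ^ 2 + δ * (1 + τ * G0) ^ 2) / M ^ 2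

lemma pt_alg (ε β τ δ M g g' q G0 G1 e0 X Y U A k k' : ℝ) (hε : 0 < ε) (hβ : 0 < β) (hτ : 0 < τ) (hδ : 0 < δ)
    (hM : 0 < M) (hτβ : τ * β ^ 2 = ε ^ 2) (hg : 0 ≤ g) (hgG : g ≤ G0) (hg' : |g'| ≤ G1) (hq : 0 ≤ q) (he0 : 0 ≤ e0)
    (hgq : 2 * π ^ 2 / M ^ 2 * g ≤ q + e0) (hX : 0 ≤ X) (hY : 0 ≤ Y) (hU : 0 < U)
    (hA : A ≤ (π ^ 2 + δ * τ) * U) (hk : k = (1 + τ * g) / M) (hk' : k' = τ * g' / M) :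
    (β⁻¹) ^ 2 * (ε / k) * ((1 + τ) * Y * U + (1 + 1 / τ) * (k' / k) ^ 2 * X * A) + X * (k / ε) * A
      - (π / (ε * M)) ^ 2 * (X * (ε / k) * U) ≤
    (β⁻¹) ^ 2 * ε * U * M * ((1 + τ) * Y + (q + rhoE τ δ G0 G1 e0 M) * X) := by
  have h1 : 0 < 1 + τ * g := by positivity
  have hkp : 0 < k := by rw [hk]; positivity
  set P := π ^ 2 + δ * τ with hP
  have hPp : 0 < P := by positivity
  have hG0 : 0 ≤ G0 := hg.trans hgG
  have hkk : (k' / k) ^ 2 ≤ τ ^ 2 * G1 ^ 2 := by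
    have : k' / k = τ * g' / (1 + τ * g) := by rw [hk, hk']; field_simp
    rw [this, div_pow, mul_pow]
    have e1 : g' ^ 2 ≤ G1 ^ 2 := by rw [← sq_abs]; gcongr
    have e2 : 1 ≤ (1 + τ * g) ^ 2 := by nlinarith [mul_nonneg hτ.le hg]
    calc τ ^ 2 * g' ^ 2 / (1 + τ * g) ^ 2 ≤ τ ^ 2 * g' ^ 2 / 1 := by gcongr
      _ ≤ _ := by rw [div_one]; gcongr
  have st1 : (β⁻¹) ^ 2 * (ε / k) * ((1 + τ) * Y * U + (1 + 1 / τ) * (k' / k) ^ 2 * X * A) + X * (k / ε) * A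
      - (π / (ε * M)) ^ 2 * (X * (ε / k) * U) ≤
      (β⁻¹) ^ 2 * (ε / k) * ((1 + τ) * Y * U + (1 + 1 / τ) * (τ ^ 2 * G1 ^ 2) * X * (P * U)) + X * (k / ε) * (P * U)
      - (π / (ε * M)) ^ 2 * (X * (ε / k) * U) := by
    have a1 : (1 + 1 / τ) * (k' / k) ^ 2 * X * A ≤ (1 + 1 / τ) * (τ ^ 2 * G1 ^ 2) * X * (P * U) :=
      calc _ ≤ (1 + 1 / τ) * (k' / k) ^ 2 * X * (P * U) := by gcongr
        _ ≤ _ := by gcongr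
    have a2 : X * (k / ε) * A ≤ X * (k / ε) * (P * U) := by gcongr
    have a3 : (β⁻¹) ^ 2 * (ε / k) * ((1 + τ) * Y * U + (1 + 1 / τ) * (k' / k) ^ 2 * X * A) ≤
       (β⁻¹) ^ 2 * (ε / k) * ((1 + τ) * Y * U + (1 + 1 / τ) * (τ ^ 2 * G1 ^ 2) * X * (P * U)) := by gcongr
    linarith
  set J := (1 + τ) * Y + ((τ + τ ^ 2) * G1 ^ 2 * P + (π ^ 2 * (2 * g + τ * g ^ 2) + δ * (1 + τ * g) ^ 2) / M ^ 2) * X with hJ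
  have st2 : (β⁻¹) ^ 2 * (ε / k) * ((1 + τ) * Y * U + (1 + 1 / τ) * (τ ^ 2 * G1 ^ 2) * X * (P * U)) + X * (k / ε) * (P * U)
      - (π / (ε * M)) ^ 2 * (X * (ε / k) * U) = (β⁻¹) ^ 2 * ε * U * (1 / k) * J := by
    have e1 : X * (k / ε) * (P * U) = (β⁻¹) ^ 2 * ε * U * (1 / k) * (k ^ 2 * P / τ * X) := by
      have : β⁻¹ ^ 2 = τ / ε ^ 2 := by rw [← hτβ]; field_simp
      rw [this]; field_simp
    have e2 : (π / (ε * M)) ^ 2 * (X * (ε / k) * U) = (β⁻¹) ^ 2 * ε * U * (1 / k) * (π ^ 2 / M ^ 2 / τ * X) := by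
      have : β⁻¹ ^ 2 = τ / ε ^ 2 := by rw [← hτβ]; field_simp
      rw [this]; field_simp
    have e3 : k ^ 2 * P / τ * X - π ^ 2 / M ^ 2 / τ * X =
        ((π ^ 2 * (2 * g + τ * g ^ 2) + δ * (1 + τ * g) ^ 2) / M ^ 2) * X := by
      rw [hk, hP]; field_simp; ring
    have e4 : (β⁻¹) ^ 2 * (ε / k) * ((1 + τ) * Y * U + (1 + 1 / τ) * (τ ^ 2 * G1 ^ 2) * X * (P * U)) =
        (β⁻¹) ^ 2 * ε * U * (1 / k) * ((1 + τ) * Y + (τ + τ ^ 2) * G1 ^ 2 * P * X) := by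
      field_simp
      ring
    have : J = ((1 + τ) * Y + (τ + τ ^ 2) * G1 ^ 2 * P * X) + (k ^ 2 * P / τ * X - π ^ 2 / M ^ 2 / τ * X) := by
      rw [e3, hJ]; ring
    rw [e1, e2, e4, this]; ring
  have hJ0 : 0 ≤ J := by positivity
  have hkM : 1 / k ≤ M := by
    rw [hk, one_div_div, div_le_iff₀ h1]
    nlinarith [mul_nonneg hM.le (mul_nonneg hτ.le hg)]
  have hJle : J ≤ (1 + τ) * Y + (q + rhoE τ δ G0 G1 e0 M) * X := by
    have a1 : (π ^ 2 * (2 * g + τ * g ^ 2) + δ * (1 + τ * g) ^ 2) / M ^ 2 ≤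
        2 * π ^ 2 / M ^ 2 * g + (π ^ 2 * τ * G0 ^ 2 + δ * (1 + τ * G0) ^ 2) / M ^ 2 := by
      calc _ = 2 * π ^ 2 / M ^ 2 * g + (π ^ 2 * τ * g ^ 2 + δ * (1 + τ * g) ^ 2) / M ^ 2 := by field_simp; ring
        _ ≤ _ := by gcongr
    have a2 : (τ + τ ^ 2) * G1 ^ 2 * P + (π ^ 2 * (2 * g + τ * g ^ 2) + δ * (1 + τ * g) ^ 2) / M ^ 2 ≤ q + rhoE τ δ G0 G1 e0 M := by
      unfold rhoE; linarith
    have := mul_le_mul_of_nonneg_right a2 hX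
    linarith
  rw [st2] at st1
  refine st1.trans ?_
  calc (β⁻¹) ^ 2 * ε * U * (1 / k) * J ≤ (β⁻¹) ^ 2 * ε * U * M * J := by gcongr
    _ ≤ _ := by gcongr

lemma trial_est {h χ u g q : ℝ → ℝ} {ε β τ δ R G0 G1 e0 S : ℝ} (hε : 0 < ε) (hβ : 0 < β) (hτ : 0 < τ) (hδ : 0 < δ)
    (hpos : ∀ x, 0 < h x) (hle : ∀ x, h x ≤ h 0) (hR : 0 < R)
    (hτβ : τ * β ^ 2 = ε ^ 2) (hgs : ContDiff ℝ (⊤ : ℕ∞) g) (hg : ∀ t, 0 ≤ g t) (hgG : ∀ t, |t| ≤ R → g t ≤ G0)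
    (hg' : ∀ t, |t| ≤ R → |deriv g t| ≤ G1) (hqc : Continuous q) (hq : ∀ t, 0 ≤ q t) (he0 : 0 ≤ e0)
    (hgq : ∀ t, |t| ≤ R → 2 * π ^ 2 / h 0 ^ 2 * g t ≤ q t + e0)
    (hu : ContDiff ℝ (⊤ : ℕ∞) u) (hucs : HasCompactSupport u) (hu1 : tsupport u ⊆ Ioo 0 1)
    (hU : 0 < ∫ s, u s ^ 2) (hA : (∫ s, deriv u s ^ 2) ≤ (π ^ 2 + δ * τ) * ∫ s, u s ^ 2)
    (hχ : ContDiff ℝ (⊤ : ℕ∞) χ) (hχcs : HasCompactSupport χ) (hχR : ∀ t, R < |t| → χ t = 0) (hS : 0 ≤ S)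
    (hχS : (∫ t, (deriv χ t ^ 2 + q t * χ t ^ 2)) ≤ S * ∫ t, χ t ^ 2)
    (hh : ∀ t, |t| ≤ R → h 0 ≤ h (β * t) * (1 + τ * g t)) :
    let ψ := trial χ u (fun t => (1 + τ * g t) / h 0) β ε
    (ContDiff ℝ (⊤ : ℕ∞) ψ ∧ HasCompactSupport ψ ∧ tsupport ψ ⊆ {p : ℝ × ℝ | 0 < p.2 ∧ p.2 < ε * h p.1}) ∧
    (∫ p in {p : ℝ × ℝ | 0 < p.2 ∧ p.2 < ε * h p.1}, gradSq ψ p) ≤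
      ((π / (ε * h 0)) ^ 2 + (β⁻¹) ^ 2 * (((1 + τ) * S + rhoE τ δ G0 G1 e0 (h 0)) * (1 + τ * G0))) *
       ∫ p in {p : ℝ × ℝ | 0 < p.2 ∧ p.2 < ε * h p.1}, ψ p ^ 2 := by
  intro ψ
  have hM := hpos 0
  set M := h 0 with hMd
  set k : ℝ → ℝ := fun t => (1 + τ * g t) / M with hk
  have hk0 : ∀ t, 0 < k t := fun t => by
    have := hg t
    simp only [hk]; positivity
  have hks : ContDiff ℝ (⊤ : ℕ∞) k := by
    simp only [hk]
    exact (contDiff_const.add (contDiff_const.mul hgs)).div_const M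
  have hk' : ∀ t, deriv k t = τ * deriv g t / M := fun t =>
    ((((diff1 hgs t).hasDerivAt.const_mul τ).const_add 1).div_const M).deriv
  have hψ : ContDiff ℝ (⊤ : ℕ∞) ψ := trial_smooth hχ hu hks
  obtain ⟨hs, hΩ⟩ := trial_supp (h := h) (χ := χ) (u := u) (k := k) (R := R) hε hβ hle hχR hu1 hks.continuous hk0 (fun t ht => by
    simp only [hk]
    rw [mul_div_assoc', le_div_iff₀ hM, one_mul]
    exact hh t ht)
  refine ⟨⟨hψ, hs, hΩ⟩, ?_⟩
  set Ω := {p : ℝ × ℝ | 0 < p.2 ∧ p.2 < ε * h p.1} with hΩd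
  set U := ∫ s, u s ^ 2 with hUd
  set A := ∫ s, deriv u s ^ 2 with hAd
  have hkc := hks.continuous
  have hk'c := (deriv_smooth1 hks).continuous
  have hχc := hχ.continuous
  have hχ'c := (deriv_smooth1 hχ).continuous
  set fD : ℝ → ℝ := fun t => χ t ^ 2 * (ε / k t) * U with hfD
  set fX : ℝ → ℝ := fun t => (β⁻¹) ^ 2 * (ε / k t) * ((1 + τ) * deriv χ t ^ 2 * U +
        (1 + 1 / τ) * (deriv k t / k t) ^ 2 * χ t ^ 2 * A) with hfX
  set fY : ℝ → ℝ := fun t => χ t ^ 2 * (k t / ε) * A with hfY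
  have hcε : Continuous fun t => ε / k t := continuous_const.div hkc fun t => (hk0 t).ne'
  have hck : Continuous fun t => deriv k t / k t := hk'c.div hkc fun t => (hk0 t).ne'
  have hz : ∀ t ∉ tsupport χ, χ t = 0 ∧ deriv χ t = 0 := fun t ht =>
    ⟨image_eq_zero_of_notMem_tsupport ht,
      image_eq_zero_of_notMem_tsupport fun h' => ht (tsupport_deriv_subset h')⟩
  have iD : Integrable fD := by
    refine Continuous.integrable_of_hasCompactSupport (by fun_prop) ?_
    exact HasCompactSupport.intro hχcs.isCompact fun t ht => by simp [hfD, hz t ht]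
  have iX : Integrable fX := by
    refine Continuous.integrable_of_hasCompactSupport (by fun_prop) ?_
    exact HasCompactSupport.intro hχcs.isCompact fun t ht => by simp [hfX, hz t ht]
  have iY : Integrable fY := by
    refine Continuous.integrable_of_hasCompactSupport (by fun_prop) ?_
    exact HasCompactSupport.intro hχcs.isCompact fun t ht => by simp [hfY, hz t ht]
  have sc : ∀ f : ℝ → ℝ, ∫ x, f (β⁻¹ * x) = β * ∫ t, f t := fun f => by
    rw [Measure.integral_comp_mul_left f β⁻¹, inv_inv, abs_of_pos hβ, smul_eq_mul]
  have hD : ∫ p in Ω, ψ p ^ 2 = β * ∫ t, fD t := by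
    rw [mass_eq hψ hs hΩ, ← sc]
    exact integral_congr_ae (Eventually.of_forall fun x => trial_mass_slice hε hk0 x)
  have hE : ∫ p in Ω, gradSq ψ p ≤ β * (∫ t, fX t) + β * ∫ t, fY t := by
    rw [energy_eq hψ hs hΩ, ← sc, ← sc]
    apply add_le_add
    · refine integral_mono ?_ (iX.comp_mul_left' (inv_pos.mpr hβ).ne') ?_
      · exact Continuous.integrable_of_hasCompactSupport
          (PI_smooth (sq_smooth (dX_smooth hψ)) (sq_cs (dX_cs hs)) continuous_const).continuous (PI_cs (sq_cs (dX_cs hs)) _)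
      · intro x
        refine trial_dX_slice hχ hu hks hucs hu1 hε hk0 τ hτ x ?_
        have := slice_int (sq_smooth (dX_smooth hψ)).continuous (sq_cs (dX_cs hs)) (w := fun _ => 1) continuous_const x
        simpa using this
    · exact le_of_eq (integral_congr_ae (Eventually.of_forall fun x => trial_dY_slice hχ hu hks hε hk0 x))
  set ρ := rhoE τ δ G0 G1 e0 M with hρ
  set V0 := (π / (ε * M)) ^ 2 with hV0
  have hG0 : 0 ≤ G0 := (hg 0).trans (hgG 0 (by simp [hR.le]))
  have hρ0 : 0 ≤ ρ := by rw [hρ]; unfold rhoE; positivity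
  have hout : ∀ t, R < |t| → χ t = 0 ∧ deriv χ t = 0 := by
    intro t ht
    refine ⟨hχR t ht, ?_⟩
    have : χ =ᶠ[nhds t] fun _ => 0 := by
      have : {s : ℝ | R < |s|} ∈ nhds t := (isOpen_lt continuous_const continuous_abs).mem_nhds ht
      filter_upwards [this] with s hs
      exact hχR s hs
    rw [this.deriv_eq]; simp
  have hpt : ∀ t, fX t + fY t - V0 * fD t ≤
      (β⁻¹) ^ 2 * ε * U * M * ((1 + τ) * deriv χ t ^ 2 + (q t + ρ) * χ t ^ 2) := by
    intro t
    by_cases ht : |t| ≤ R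
    · exact pt_alg ε β τ δ M (g t) (deriv g t) (q t) G0 G1 e0 (χ t ^ 2) (deriv χ t ^ 2) U A (k t) (deriv k t) hε hβ hτ hδ hM hτβ
        (hg t) (hgG t ht) (hg' t ht) (hq t) he0 (hgq t ht) (sq_nonneg _) (sq_nonneg _) hU hA rfl (hk' t)
    · obtain ⟨o1, o2⟩ := hout t (not_le.mp ht)
      simp [hfX, hfY, hfD, o1, o2]
  have i1 : Integrable fun t => deriv χ t ^ 2 + q t * χ t ^ 2 := by
    refine Continuous.integrable_of_hasCompactSupport (by fun_prop) ?_
    exact HasCompactSupport.intro hχcs.isCompact fun t ht => by simp [hz t ht]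
  have i2 : Integrable fun t => χ t ^ 2 := 
    Continuous.integrable_of_hasCompactSupport (by fun_prop) (sq_cs hχcs)
  have hDlow : ε * U * M * (∫ t, χ t ^ 2) ≤ (1 + τ * G0) * ∫ t, fD t := by
    rw [← integral_const_mul (ε * U * M), ← integral_const_mul (1 + τ * G0)]
    refine integral_mono (i2.const_mul _) (iD.const_mul _) fun t => ?_
    by_cases ht : |t| ≤ R
    · simp only [hfD, hk]
      have h1 := hgG t ht
      have h2 := hg t
      have h3 : 0 < 1 + τ * g t := by positivity
      have e : (1 + τ * G0) * (χ t ^ 2 * (ε / ((1 + τ * g t) / M)) * U) = ε * U * M * χ t ^ 2 * ((1 + τ * G0) / (1 + τ * g t)) := by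
        field_simp
      rw [e]
      refine le_mul_of_one_le_right (by positivity) ?_
      rw [one_le_div h3]
      gcongr
    · obtain ⟨o1, o2⟩ := hout t (not_le.mp ht)
      simp [hfD, o1]
  have hmain : (∫ t, fX t) + (∫ t, fY t) - V0 * (∫ t, fD t) ≤
      (β⁻¹) ^ 2 * ε * U * M * (((1 + τ) * S + ρ) * ∫ t, χ t ^ 2) := by
    have e : (∫ t, fX t) + (∫ t, fY t) - V0 * (∫ t, fD t) = ∫ t, (fX t + fY t - V0 * fD t) := by
      have a1 : ∫ t, (fX t + fY t - V0 * fD t) = (∫ t, (fX t + fY t)) - ∫ t, V0 * fD t :=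
        integral_sub (iX.add iY) (iD.const_mul _)
      rw [a1, integral_add iX iY, integral_const_mul]
    rw [e]
    have i3 : Integrable fun t => (1 + τ) * (deriv χ t ^ 2 + q t * χ t ^ 2) + ρ * χ t ^ 2 :=
      (i1.const_mul _).add (i2.const_mul _)
    calc ∫ t, (fX t + fY t - V0 * fD t) ≤
        ∫ t, (β⁻¹) ^ 2 * ε * U * M * ((1 + τ) * (deriv χ t ^ 2 + q t * χ t ^ 2) + ρ * χ t ^ 2) := by
          refine integral_mono ((iX.add iY).sub (iD.const_mul _)) (i3.const_mul _) fun t => (hpt t).trans ?_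
          have := mul_nonneg hτ.le (mul_nonneg (hq t) (sq_nonneg (χ t)))
          apply mul_le_mul_of_nonneg_left _ (by positivity)
          linarith
      _ = (β⁻¹) ^ 2 * ε * U * M * ((1 + τ) * (∫ t, (deriv χ t ^ 2 + q t * χ t ^ 2)) + ρ * ∫ t, χ t ^ 2) := by
          have a1 : ∫ t, ((1 + τ) * (deriv χ t ^ 2 + q t * χ t ^ 2) + ρ * χ t ^ 2) =
            (∫ t, (1 + τ) * (deriv χ t ^ 2 + q t * χ t ^ 2)) + ∫ t, ρ * χ t ^ 2 :=
              integral_add (i1.const_mul _) (i2.const_mul _)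
          rw [integral_const_mul, a1, integral_const_mul, integral_const_mul]
      _ ≤ _ := by
          apply mul_le_mul_of_nonneg_left _ (by positivity)
          have := mul_le_mul_of_nonneg_left hχS (by positivity : 0 ≤ 1 + τ)
          linarith
  rw [hD]
  refine hE.trans ?_
  have c1 : 0 ≤ (β⁻¹) ^ 2 * ((1 + τ) * S + ρ) := by positivity
  have c2 := mul_le_mul_of_nonneg_left hDlow c1
  have c3 : (∫ t, fX t) + (∫ t, fY t) ≤ (V0 + (β⁻¹) ^ 2 * (((1 + τ) * S + ρ) * (1 + τ * G0))) * ∫ t, fD t := by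
    linarith
  have := mul_le_mul_of_nonneg_left c3 hβ.le
  linarith

section M
variable {h : ℝ → ℝ} {m cp cm K η : ℝ}

lemma upper_sub (H : Hyp h m cp cm K η) {j : ℕ} (hj : 1 ≤ j) (G : Submodule ℝ (ℝ → ℝ))
    (hG : Module.finrank ℝ G = j)
    (hG2 : ∀ χ ∈ G, ContDiff ℝ (⊤ : ℕ∞) χ ∧ HasCompactSupport χ) (S : ℝ) (hS : 0 ≤ S)
    (hGS : ∀ χ ∈ G, (∫ x : ℝ, (deriv χ x ^ 2 + (2 * π ^ 2 / h 0 ^ 3 * Qf m cp cm x) * χ x ^ 2)) ≤ S * ∫ x : ℝ, χ x ^ 2)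
    (δ' : ℝ) (hδ' : 0 < δ') :
    ∃ β0 > 0, ∀ ε β : ℝ, 0 < ε → 0 < β → β < β0 → β ^ m * β ^ 2 = ε ^ 2 →
    ∃ F : Submodule ℝ ((ℝ × ℝ) → ℝ), Module.finrank ℝ F = j ∧
    (∀ ψ ∈ F, ContDiff ℝ (⊤ : ℕ∞) ψ ∧ HasCompactSupport ψ ∧
      tsupport ψ ⊆ {p : ℝ × ℝ | 0 < p.2 ∧ p.2 < ε * h p.1}) ∧
    ∀ ψ ∈ F, ψ ≠ 0 → (∫ p in {p : ℝ × ℝ | 0 < p.2 ∧ p.2 < ε * h p.1}, gradSq ψ p) ≤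
      ((π / (ε * h 0)) ^ 2 + (β⁻¹) ^ 2 * (S + δ')) * ∫ p in {p : ℝ × ℝ | 0 < p.2 ∧ p.2 < ε * h p.1}, ψ p ^ 2 := by
  haveI := fd_of_finrank hj hG
  obtain ⟨R, hR, hGR⟩ := common_support G fun χ hχ => (hG2 χ hχ).2
  have hm := H.hm
  have hM := H.pos 0
  have hpi := pi_pos
  have hKp := H.hK
  have hηp := H.hη
  set M := h 0 with hMd
  set δ := δ' * M ^ 2 / (2 * (4 * π ^ 2 + 1)) with hδd
  have hδ : 0 < δ := by positivity
  set e0 := 4 * π ^ 2 * δ / M ^ 2 with he0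
  have hQc : Continuous (Qf m cp cm) := Qf_cont hm
  obtain ⟨g, hgs, hgd, -⟩ := Continuous.exists_contDiff_approx (⊤ : ℕ∞)
    (f := fun t => Qf m cp cm t / M + 3 / 2 * δ) (ε := fun _ => δ / 2) (by fun_prop) continuous_const (fun _ => by positivity)
  have hQ0 : ∀ t, 0 ≤ Qf m cp cm t := Qf_nonneg H.hcp H.hcm
  have hg1 : ∀ t, Qf m cp cm t / M + δ ≤ g t := fun t => by
    have := (abs_lt.mp (by simpa [Real.dist_eq] using hgd t)).1
    linarith
  have hg2 : ∀ t, g t ≤ Qf m cp cm t / M + 2 * δ := fun t => by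
    have := (abs_lt.mp (by simpa [Real.dist_eq] using hgd t)).2
    linarith
  have hg0 : ∀ t, 0 ≤ g t := fun t => by
    have := hg1 t
    have := div_nonneg (hQ0 t) hM.le
    linarith
  obtain ⟨G0, hG0⟩ := (isCompact_Icc (a := -R) (b := R)).exists_bound_of_continuousOn hgs.continuous.continuousOn
  obtain ⟨G1, hG1⟩ := (isCompact_Icc (a := -R) (b := R)).exists_bound_of_continuousOn (deriv_smooth1 hgs).continuous.continuousOn
  have hgG : ∀ t, |t| ≤ R → g t ≤ G0 := fun t ht => (le_abs_self _).trans (hG0 t (abs_le.mp ht))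
  have hgG' : ∀ t, |t| ≤ R → |deriv g t| ≤ G1 := fun t ht => hG1 t (abs_le.mp ht)
  have hG0p : 0 ≤ G0 := (hg0 0).trans (hgG 0 (by simp [hR.le]))
  -- small tau
  have hcont : Continuous fun τ : ℝ => ((1 + τ) * S + rhoE τ δ G0 G1 e0 M) * (1 + τ * G0) := by
    unfold rhoE; fun_prop
  have hval : ((1 + 0) * S + rhoE 0 δ G0 G1 e0 M) * (1 + 0 * G0) < S + δ' := by
    have : ((1 + 0) * S + rhoE 0 δ G0 G1 e0 M) * (1 + 0 * G0) = S + δ' / 2 := by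
      unfold rhoE
      rw [he0, hδd]; field_simp; ring
    rw [this]; linarith
  have hev : ∀ᶠ τ in nhds (0 : ℝ), ((1 + τ) * S + rhoE τ δ G0 G1 e0 M) * (1 + τ * G0) < S + δ' :=
    hcont.continuousAt.eventually_lt continuousAt_const hval
  obtain ⟨τ0, hτ0, hτ⟩ := Metric.eventually_nhds_iff.mp hev
  have hRm : 0 < R ^ (m + 1) := Real.rpow_pos_of_pos hR _
  refine ⟨min 1 (min τ0 (min (η / R) (min (δ * M / 2 / (K * R ^ (m + 1))) (δ / 2 / (G0 ^ 2 + 1))))), by positivity, ?_⟩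
  intro ε β hε hβ hβ0 hβε
  simp only [lt_min_iff] at hβ0
  obtain ⟨b1, b2, b3, b4, b5⟩ := hβ0
  rw [lt_div_iff₀ (by positivity)] at b3 b4 b5
  have hbm : 0 < β ^ m := Real.rpow_pos_of_pos hβ m
  have hbmle : β ^ m ≤ β := by
    simpa using Real.rpow_le_rpow_of_exponent_ge hβ b1.le hm
  set τ := β ^ m with hτd
  have hτs := hτ (y := τ) (by rw [Real.dist_eq, sub_zero, abs_of_pos hbm]; linarith)
  have hτG : τ * G0 ^ 2 ≤ δ / 2 := by
    have : τ * (G0 ^ 2 + 1) ≤ β * (G0 ^ 2 + 1) := by gcongr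
    linarith
  obtain ⟨u, hu, hucs, hu1, hU, hA⟩ := exists_u (δ * τ) (by positivity)
  have hh : ∀ t, |t| ≤ R → M ≤ h (β * t) * (1 + τ * g t) := by
    intro t ht
    have hx : |β * t| ≤ η := by
      rw [abs_mul, abs_of_pos hβ]
      have := mul_le_mul_of_nonneg_left ht hβ.le
      linarith
    have h1 := (abs_le.mp (H.exp (β * t) hx)).1
    rw [Qf_scale hβ, abs_mul, abs_of_pos hβ, Real.mul_rpow hβ.le (abs_nonneg t),
      Real.rpow_add_one hβ.ne'] at h1
    have h2 : |t| ^ (m + 1) ≤ R ^ (m + 1) := Real.rpow_le_rpow (abs_nonneg t) ht (by linarith)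
    have h3 : K * (τ * β * |t| ^ (m + 1)) ≤ τ * (δ * M / 2) := by
      calc K * (τ * β * |t| ^ (m + 1)) ≤ K * (τ * β * R ^ (m + 1)) := by gcongr
        _ = τ * (β * (K * R ^ (m + 1))) := by ring
        _ ≤ _ := by gcongr
    have hg1t := hg1 t
    have hgp := hg0 t
    have hMg : Qf m cp cm t + δ * M ≤ M * g t := by
      have := mul_le_mul_of_nonneg_left hg1t hM.le
      have e : M * (Qf m cp cm t / M + δ) = Qf m cp cm t + δ * M := by field_simp
      linarith
    have h4 : M - τ * (M * g t - δ * M / 2) ≤ h (β * t) := by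
      have h5 := mul_le_mul_of_nonneg_left hMg hbm.le
      have h1' : -(K * (τ * β * |t| ^ (m + 1))) ≤ h (β * t) - (M - τ * Qf m cp cm t) := h1
      linarith
    have h5 : 0 ≤ 1 + τ * g t := by positivity
    refine le_trans ?_ (mul_le_mul_of_nonneg_right h4 h5)
    have h6 : τ * g t ^ 2 ≤ δ / 2 := by
      refine le_trans ?_ hτG
      have := hgG t ht
      gcongr
    have e : (M - τ * (M * g t - δ * M / 2)) * (1 + τ * g t) = M + τ * M * (δ / 2 - τ * g t ^ 2) + τ ^ 2 * (δ * M / 2) * g t := by ring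
    rw [e]
    have h7 : 0 ≤ τ * M * (δ / 2 - τ * g t ^ 2) := mul_nonneg (by positivity) (by linarith)
    have h8 : 0 ≤ τ ^ 2 * (δ * M / 2) * g t := by positivity
    linarith
  have key := fun χ (hχ : χ ∈ G) => trial_est (h := h) (χ := χ) (u := u) (g := g) (q := fun t => 2 * π ^ 2 / M ^ 3 * Qf m cp cm t)
    (R := R) (G0 := G0) (G1 := G1) (e0 := e0) (S := S) hε hβ hbm hδ H.pos H.le hR hβε hgs hg0 hgG hgG' (by fun_prop)
    (fun t => mul_nonneg (by positivity) (hQ0 t)) (by positivity) (fun t _ => by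
      have := mul_le_mul_of_nonneg_left (hg2 t) (by positivity : 0 ≤ 2 * π ^ 2 / M ^ 2)
      refine this.trans (le_of_eq ?_)
      rw [he0]; field_simp; ring) hu hucs hu1 hU hA (hG2 χ hχ).1 (hG2 χ hχ).2 (hGR χ hχ) hS (hGS χ hχ) hh
  set k : ℝ → ℝ := fun t => (1 + τ * g t) / M with hk
  have hk0 : ∀ t, 0 < k t := fun t => by
    have := hg0 t
    simp only [hk]; positivity
  let T : G →ₗ[ℝ] (ℝ × ℝ → ℝ) :=
    { toFun := fun χ => trial χ.1 u k β ε
      map_add' := by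
        intro a b; funext p; simp [trial, add_mul]
      map_smul' := by
        intro c a; funext p; simp [trial, mul_assoc] }
  obtain ⟨s0, hs0⟩ : ∃ s, u s ≠ 0 := by
    by_contra hcon
    push Not at hcon
    simp [hcon] at hU
  have hTinj : Function.Injective T := by
    rw [← LinearMap.ker_eq_bot, LinearMap.ker_eq_bot']
    intro a ha
    apply Subtype.ext
    funext t
    have h1 : trial a.1 u k β ε (β * t, s0 * ε / k t) = 0 := congrFun ha _
    unfold trial at h1
    simp only [inv_mul_cancel_left₀ hβ.ne'] at h1
    have e : ε⁻¹ * k t * (s0 * ε / k t) = s0 := by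
      have := hk0 t
      field_simp
    rw [e] at h1
    exact (mul_eq_zero.mp h1).resolve_right hs0
  refine ⟨LinearMap.range T, ?_, ?_, ?_⟩
  · rw [LinearMap.finrank_range_of_inj hTinj, hG]
  · rintro _ ⟨a, rfl⟩
    exact (key a.1 a.2).1
  · rintro _ ⟨a, rfl⟩ -
    refine ((key a.1 a.2).2).trans ?_
    refine mul_le_mul_of_nonneg_right ?_ (integral_nonneg fun _ => sq_nonneg _)
    gcongr

lemma exists_jdim (j : ℕ) : ∃ G : Submodule ℝ (ℝ → ℝ), Module.finrank ℝ G = j ∧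
    ∀ χ ∈ G, ContDiff ℝ (⊤ : ℕ∞) χ ∧ HasCompactSupport χ := by
  let b : ∀ i : Fin j, ContDiffBump ((3 : ℝ) * (i : ℕ)) := fun i => ⟨1 / 2, 1, by norm_num, by norm_num⟩
  have hli : LinearIndependent ℝ (fun i : Fin j => (b i : ℝ → ℝ)) := by
    rw [Fintype.linearIndependent_iff]
    intro c hc i
    have h1 := congrFun hc ((3 : ℝ) * (i : ℕ))
    simp only [Finset.sum_apply, Pi.smul_apply, smul_eq_mul, Pi.zero_apply] at h1
    rw [Finset.sum_eq_single i] at h1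
    · have : b i ((3 : ℝ) * (i : ℕ)) = 1 := (b i).one_of_mem_closedBall (by simp [b])
      rw [this, mul_one] at h1
      exact h1
    · intro k _ hki
      have : b k ((3 : ℝ) * (i : ℕ)) = 0 := by
        apply (b k).zero_of_le_dist
        show (1 : ℝ) ≤ _
        rw [Real.dist_eq, ← mul_sub, abs_mul]
        have hne : ((i : ℕ) : ℤ) - ((k : ℕ) : ℤ) ≠ 0 := by
          intro h0
          apply hki
          apply Fin.ext
          omega
        have h2 : (1 : ℤ) ≤ |((i : ℕ) : ℤ) - ((k : ℕ) : ℤ)| := Int.one_le_abs hne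
        have h3 : (1 : ℝ) ≤ |((i : ℕ) : ℝ) - ((k : ℕ) : ℝ)| := by exact_mod_cast h2
        rw [abs_of_pos (by norm_num : (0 : ℝ) < 3)]
        linarith
      rw [this, mul_zero]
    · simp
  refine ⟨Submodule.span ℝ (Set.range fun i : Fin j => (b i : ℝ → ℝ)), ?_, ?_⟩
  · rw [finrank_span_eq_card hli]; simp
  · intro χ hχ
    induction hχ using Submodule.span_induction with
    | mem x hx =>
      obtain ⟨i, rfl⟩ := hx
      exact ⟨(b i).contDiff, (b i).hasCompactSupport⟩
    | zero => exact ⟨contDiff_const, HasCompactSupport.zero⟩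
    | add x y _ _ hx hy => exact ⟨hx.1.add hy.1, hx.2.add hy.2⟩
    | smul a x _ hx => exact ⟨hx.1.const_smul a, hx.2.smul_left (f := fun _ => a)⟩

lemma two_sided (H : Hyp h m cp cm K η) {j : ℕ} (hj : 1 ≤ j) (δ : ℝ) (hδ : 0 < δ) :
    ∃ β0 > 0, ∀ ε β : ℝ, 0 < ε → 0 < β → β < β0 → β ^ m * β ^ 2 = ε ^ 2 →
    schroedingerMinMax (fun t => 2 * π ^ 2 / h 0 ^ 3 * Qf m cp cm t) j - δ ≤
      β ^ 2 * (dirichletMinMax {p : ℝ × ℝ | 0 < p.2 ∧ p.2 < ε * h p.1} j - (π / (ε * h 0)) ^ 2) ∧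
    β ^ 2 * (dirichletMinMax {p : ℝ × ℝ | 0 < p.2 ∧ p.2 < ε * h p.1} j - (π / (ε * h 0)) ^ 2) ≤
    schroedingerMinMax (fun t => 2 * π ^ 2 / h 0 ^ 3 * Qf m cp cm t) j + δ := by
  have hM := H.pos 0
  have hpi := pi_pos
  have hqc : Continuous fun t => 2 * π ^ 2 / h 0 ^ 3 * Qf m cp cm t := continuous_const.mul (Qf_cont H.hm)
  set q := fun t => 2 * π ^ 2 / h 0 ^ 3 * Qf m cp cm t with hq
  have hq0 : ∀ t, 0 ≤ q t := fun t => mul_nonneg (by positivity) (Qf_nonneg H.hcp H.hcm t)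
  obtain ⟨G', hG', hG2'⟩ := exists_jdim j
  obtain ⟨S, ⟨G, hG, hG2, hSG⟩, hSlt⟩ := exists_lt_of_csInf_lt (s := { r : ℝ | ∃ F : Submodule ℝ (ℝ → ℝ),
    Module.finrank ℝ F = j ∧
    (∀ χ ∈ F, ContDiff ℝ (⊤ : ℕ∞) χ ∧ HasCompactSupport χ) ∧
    r = sSup { s : ℝ | ∃ χ ∈ F, χ ≠ (0 : ℝ → ℝ) ∧
      s = (∫ x : ℝ, (deriv χ x ^ 2 + q x * χ x ^ 2)) / (∫ x : ℝ, χ x ^ 2) } })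
      ⟨_, G', hG', hG2', rfl⟩ (show sInf _ < schroedingerMinMax q j + δ / 2 by
        show schroedingerMinMax q j < _
        linarith)
  have hS0 : 0 ≤ S := schr_bddBelow q hq0 j S ⟨G, hG, hG2, hSG⟩
  have hGS : ∀ χ ∈ G, (∫ x : ℝ, (deriv χ x ^ 2 + q x * χ x ^ 2)) ≤ S * ∫ x : ℝ, χ x ^ 2 := by
    intro χ hχ
    by_cases h0 : χ = 0
    · subst h0; simp
    · exact ray_le_1D q hqc hj G hG hG2 S hSG χ hχ h0
  obtain ⟨β1, hβ1, hup⟩ := upper_sub H hj G hG hG2 S hS0 hGS (δ / 2) (by positivity)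
  obtain ⟨β2, hβ2, hlow⟩ := lower_main H hj δ hδ
  refine ⟨min β1 β2, by positivity, fun ε β hε hβ hβ0 hβε => ?_⟩
  obtain ⟨c1, c2⟩ := lt_min_iff.mp hβ0
  obtain ⟨F, hF, hF2, hFr⟩ := hup ε β hε hβ c1 hβε
  constructor
  · have : (schroedingerMinMax q j - δ) / β ^ 2 + (π / (ε * h 0)) ^ 2 ≤
        dirichletMinMax {p : ℝ × ℝ | 0 < p.2 ∧ p.2 < ε * h p.1} j := by
      refine le_csInf ⟨_, F, hF, hF2, rfl⟩ ?_
      rintro r ⟨F', hF', hF2', hr⟩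
      have := hlow ε β hε hβ c2 hβε r F' hF' hF2' hr
      have h2 : (schroedingerMinMax q j - δ) / β ^ 2 ≤ r - (π / (ε * h 0)) ^ 2 := by
        rw [div_le_iff₀ (by positivity)]; linarith
      linarith
    have h2 : (schroedingerMinMax q j - δ) / β ^ 2 ≤
      dirichletMinMax {p : ℝ × ℝ | 0 < p.2 ∧ p.2 < ε * h p.1} j - (π / (ε * h 0)) ^ 2 := by linarith
    rw [div_le_iff₀ (by positivity)] at h2
    linarith
  · have := dir_le _ hj F hF hF2 _ hFr
    have h2 : dirichletMinMax {p : ℝ × ℝ | 0 < p.2 ∧ p.2 < ε * h p.1} j - (π / (ε * h 0)) ^ 2 ≤ (β⁻¹) ^ 2 * (S + δ / 2) := by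
      linarith
    have h3 := mul_le_mul_of_nonneg_left h2 (sq_nonneg β)
    have e : β ^ 2 * ((β⁻¹) ^ 2 * (S + δ / 2)) = S + δ / 2 := by field_simp
    linarith

end M

lemma hyp_of (h : ℝ → ℝ)
    (hcont : Continuous h)
    (hpos : ∀ x : ℝ, 0 < h x)
    (hmax : ∀ x : ℝ, x ≠ 0 → h x < h 0)
    (m cp cm K η : ℝ)
    (hm : 1 ≤ m) (hcp : 0 < cp) (hcm : 0 < cm) (hK : 0 < K) (hη : 0 < η)
    (hexp_pos : ∀ x : ℝ, 0 < x → x ≤ η →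
      |h x - (h 0 - cp * x ^ m)| ≤ K * x ^ (m + 1))
    (hexp_neg : ∀ x : ℝ, -η ≤ x → x < 0 →
      |h x - (h 0 - cm * |x| ^ m)| ≤ K * |x| ^ (m + 1))
    (hlimsup : Filter.limsup h (Filter.cocompact ℝ) < h 0) : Hyp h m cp cm K η := by
  have hle : ∀ x, h x ≤ h 0 := fun x => by
    by_cases hx : x = 0
    · rw [hx]
    · exact (hmax x hx).le
  refine ⟨hcont, hpos, hle, hm, hcp, hcm, hK, hη, ?_, ?_⟩
  · intro x hx
    rcases lt_trichotomy x 0 with h1 | h1 | h1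
    · rw [Qf_neg_eq hm h1.le]
      exact hexp_neg x (abs_le.1 hx).1 h1
    · subst h1
      rw [Qf_pos_eq hm le_rfl, Real.zero_rpow (by linarith)]
      simp only [mul_zero, sub_zero, sub_self, abs_zero]
      positivity
    · rw [Qf_pos_eq hm h1.le, abs_of_pos h1]
      exact hexp_pos x h1 (abs_le.1 hx).2
  · intro ρ hρ
    obtain ⟨c, hc1, hc2⟩ := exists_between hlimsup
    have hev : ∀ᶠ x in Filter.cocompact ℝ, h x < c :=
      Filter.eventually_lt_of_limsup_lt hc1 (Filter.isBoundedUnder_of ⟨h 0, hle⟩)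
    obtain ⟨T, hT, hTs⟩ := Filter.mem_cocompact.1 hev
    have hcomp : IsCompact (T ∩ {x | ρ ≤ |x|}) :=
      hT.inter_right (isClosed_le continuous_const continuous_abs)
    rcases (T ∩ {x | ρ ≤ |x|}).eq_empty_or_nonempty with he | hne
    · refine ⟨h 0 - c, by linarith, fun x hx => ?_⟩
      have hxT : x ∉ T := fun hxT => by
        have : x ∈ T ∩ {x | ρ ≤ |x|} := ⟨hxT, hx⟩
        rw [he] at this
        exact this
      have h2 : h x < c := hTs hxT
      linarith
    · obtain ⟨x0, hx0, hm0⟩ := hcomp.exists_isMaxOn hne hcont.continuousOn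
      have hx0' : x0 ≠ 0 := by
        rintro rfl
        have : ρ ≤ |(0 : ℝ)| := hx0.2
        rw [abs_zero] at this
        linarith
      refine ⟨min (h 0 - c) (h 0 - h x0), lt_min (by linarith) (by linarith [hmax x0 hx0']), fun x hx => ?_⟩
      by_cases hxT : x ∈ T
      · have : h x ≤ h x0 := hm0 ⟨hxT, hx⟩
        exact (min_le_right _ _).trans (by linarith)
      · have h2 : h x < c := hTs hxT
        exact (min_le_left _ _).trans (by linarith)

/-- **Theorem 6.2** (Friedlander–Solomyak, infinite strip). Let `h : ℝ → ℝ` be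
continuous and positive, with unique global maximum `M = h(0)`, `C¹` away from `0`,
satisfying the expansion (ii) near `0`, and the condition (iii):
`limsup_{|x|→∞} h(x) < M` and `h'/h` bounded.  Then for every `j ≥ 1` the min–max
values of the Dirichlet Laplacian on `Ω_ε = {(x,y) : 0 < y < ε h(x)}` satisfy
`lim_{ε→0⁺} ε^{2α} (λ_j(ε) − π²/(M²ε²)) = μ_j`. -/
theorem dirichlet_laplacian_infinite_strip_two_term_asymptotics
    (h : ℝ → ℝ)
    (hcont : Continuous h)
    (hpos : ∀ x : ℝ, 0 < h x)
    (hmax : ∀ x : ℝ, x ≠ 0 → h x < h 0)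
    (hC1 : ContDiffOn ℝ 1 h {(0 : ℝ)}ᶜ)
    (m cp cm K η : ℝ)
    (hm : 1 ≤ m) (hcp : 0 < cp) (hcm : 0 < cm) (hK : 0 < K) (hη : 0 < η)
    (hexp_pos : ∀ x : ℝ, 0 < x → x ≤ η →
      |h x - (h 0 - cp * x ^ m)| ≤ K * x ^ (m + 1))
    (hexp_neg : ∀ x : ℝ, -η ≤ x → x < 0 →
      |h x - (h 0 - cm * |x| ^ m)| ≤ K * |x| ^ (m + 1))
    (hlimsup : Filter.limsup h (Filter.cocompact ℝ) < h 0)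
    (hlog : ∃ C : ℝ, ∀ x : ℝ, x ≠ 0 → |deriv h x / h x| ≤ C)
    (α : ℝ) (hα : α = 2 / (m + 2))
    (q : ℝ → ℝ)
    (hq_pos : ∀ x : ℝ, 0 < x → q x = 2 * π ^ 2 * cp * x ^ m / (h 0) ^ 3)
    (hq_neg : ∀ x : ℝ, x ≤ 0 → q x = 2 * π ^ 2 * cm * |x| ^ m / (h 0) ^ 3)
    (j : ℕ) (hj : 1 ≤ j) :
    Tendsto
      (fun ε : ℝ =>
        ε ^ (2 * α) *
          (dirichletMinMax {p : ℝ × ℝ | 0 < p.2 ∧ p.2 < ε * h p.1} j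
            - π ^ 2 / ((h 0) ^ 2 * ε ^ 2)))
      (nhdsWithin 0 (Ioi 0)) (nhds (schroedingerMinMax q j)) := by
  have H := hyp_of h hcont hpos hmax m cp cm K η hm hcp hcm hK hη hexp_pos hexp_neg hlimsup
  have hq : q = fun t => 2 * π ^ 2 / h 0 ^ 3 * Qf m cp cm t := by
    funext x
    rcases lt_or_ge 0 x with h1 | h1
    · rw [hq_pos x h1, Qf_pos_eq hm h1.le]; ring
    · rw [hq_neg x h1, Qf_neg_eq hm h1]; ring
  have hα0 : 0 < α := by rw [hα]; positivity
  have hαm : α * (m + 2) = 2 := by rw [hα]; field_simp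
  rw [Metric.tendsto_nhds]
  intro δ hδ
  obtain ⟨β0, hβ0, hb⟩ := two_sided H hj (δ / 2) (by linarith)
  have hlim : Tendsto (fun ε : ℝ => ε ^ α) (nhdsWithin 0 (Ioi 0)) (nhds 0) := by
    have h1 := (Real.continuousAt_rpow_const 0 α (Or.inr hα0.le)).tendsto
    rw [Real.zero_rpow hα0.ne'] at h1
    exact h1.mono_left nhdsWithin_le_nhds
  filter_upwards [self_mem_nhdsWithin, hlim.eventually_lt_const hβ0] with ε hε hβ
  have hε' : 0 < ε := hε
  have e1 : (ε ^ α) ^ m * (ε ^ α) ^ 2 = ε ^ 2 := by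
    rw [← Real.rpow_natCast (ε ^ α) 2, ← Real.rpow_mul hε'.le, ← Real.rpow_mul hε'.le,
      ← Real.rpow_add hε', ← Real.rpow_natCast ε 2]
    congr 1
    push_cast
    linarith
  have e2 : ε ^ (2 * α) = (ε ^ α) ^ 2 := by
    rw [← Real.rpow_natCast (ε ^ α) 2, ← Real.rpow_mul hε'.le]
    congr 1
    push_cast
    ring
  have e3 : π ^ 2 / ((h 0) ^ 2 * ε ^ 2) = (π / (ε * h 0)) ^ 2 := by
    rw [div_pow]; ring
  obtain ⟨l, u⟩ := hb ε (ε ^ α) hε' (Real.rpow_pos_of_pos hε' _) hβ e1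
  rw [e2, e3, hq, Real.dist_eq, abs_lt]
  constructor <;> linarith
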